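/- arXiv:2503.20155 — 3 statements merged into one kernel-verified Lean document; each statement's English description precedes it below -/
import Mathlib

section
/- Let m > n be positive integers. There exists an involution Φ : D_{m,n} → D_{m,n} (i.e., Φ(Φ(P)) = P for every P ∈ D_{m,n}) such that for every P ∈ D_{m,n}: comp(Φ(P)) = comp(P), run(Φ(P)) = ret(P), and ret(Φ(P)) = run(P). -/
open scoped Classical

namespace RationalDyck

/-- A lattice path: `true` = a north step `N`, `false` = an east step `E`. -/
abbrev Path : Type := List Bool

/-- The rank of the endpoint of a path prefix `Q` in the `m × n` grid:
`rank(i,j) = j*m - i*n`, where `i` is the number of east steps of `Q`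
and `j` the number of north steps of `Q`. -/
def prefRank (m n : ℕ) (Q : Path) : ℤ :=
  (Q.count true : ℤ) * m - (Q.count false : ℤ) * n

/-- `P` is an `m × n` rational Dyck path: it goes from `(0,0)` to `(m,n)` and
stays weakly above the line `y = n x / m`. -/
def IsDyck (m n : ℕ) (P : Path) : Prop :=
  P.count false = m ∧ P.count true = n ∧ ∀ i ≤ P.length, 0 ≤ prefRank m n (P.take i)

/-- The return statistic: the number of lattice points on `P` other than `(m,n)`
whose rank is strictly less than `n`. -/
def retStat (m n : ℕ) (P : Path) : ℕ :=
  ((List.range P.length).filter fun i => prefRank m n (P.take i) < (n : ℤ)).length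

/-- The coarea sequence of `P`: for each north step (from bottom to top), the number
of cells of the rectangle strictly to its left, i.e. the number of east steps before it. -/
def coarea (P : Path) : List ℕ :=
  (List.range P.length).filterMap fun i =>
    if P.getD i false = true then some ((P.take i).count false) else none

/-- The run statistic: the least `i ∈ [n]` not appearing in the coarea sequence. -/
noncomputable def runStat (P : Path) : ℕ :=
  sInf {i : ℕ | 1 ≤ i ∧ i ≤ P.count true ∧ i ∉ coarea P}

/-- The ratio-run statistic: with `k = ⌊m/n⌋`, the least `i ∈ [n]` such that `k*i`
does not appear in the coarea sequence. -/
noncomputable def ratioRun (m n : ℕ) (P : Path) : ℕ :=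
  sInf {i : ℕ | 1 ≤ i ∧ i ≤ P.count true ∧ (m / n) * i ∉ coarea P}

/-- The composition type of `P`: the lengths of the maximal blocks of consecutive
north steps, read from start to end. -/
def compType (P : Path) : List ℕ :=
  ((P.splitOn false).map List.length).filter fun x => x ≠ 0

/-- The number of maximal blocks of consecutive north steps (vertical components). -/
def nc (P : Path) : ℕ := (compType P).length

/-- `α` is a (strong) composition of `n`. -/
def IsComposition (n : ℕ) (α : List ℕ) : Prop :=
  (∀ a ∈ α, 0 < a) ∧ α.sum = n

/-- The finite set of all `m × n` rational Dyck paths. -/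
noncomputable def dyckPaths (m n : ℕ) : Finset Path :=
  ((Finset.univ : Finset (Fin (m + n) → Bool)).image List.ofFn).filter fun P => IsDyck m n P

/-- The `m × n` rational Dyck paths of composition type `α`. -/
noncomputable def dyckPathsComp (m n : ℕ) (α : List ℕ) : Finset Path :=
  (dyckPaths m n).filter fun P => compType P = α

/-- The `m × n` rational Dyck paths with `run = k` and `ret = l`. -/
noncomputable def dyckPathsRR (m n k l : ℕ) : Finset Path :=
  (dyckPaths m n).filter fun P => runStat P = k ∧ retStat m n P = l

/-- The `m × n` rational Dyck paths of composition type `α` with `run = k` and `ret = l`. -/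
noncomputable def dyckPathsCompRR (m n : ℕ) (α : List ℕ) (k l : ℕ) : Finset Path :=
  (dyckPathsComp m n α).filter fun P => runStat P = k ∧ retStat m n P = l

/-- The number of initial parts of `α` equal to `1`. -/
def iones (α : List ℕ) : ℕ := (α.takeWhile fun a => a = 1).length

/-- `rr(α, m) = min(Iones(α) + 1, ⌈n/(m-n)⌉)` where `n = |α|` is the sum of parts. -/
def rr (m : ℕ) (α : List ℕ) : ℕ :=
  min (iones α + 1) ((α.sum + (m - α.sum) - 1) / (m - α.sum))


/-- The path `N^{x₀} E N^{x₁} E ⋯` whose `i`-th column contains `xᵢ` north steps. -/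
def ofColumns (L : List ℕ) : Path :=
  L.flatMap fun x => List.replicate x true ++ [false]

/-- The numbers of north steps in the columns of a path, with `k` extra north steps
in the first one. -/
def columnsAux : ℕ → Path → List ℕ
  | _, [] => []
  | k, true :: P => columnsAux (k + 1) P
  | k, false :: P => k :: columnsAux 0 P

/-- The numbers of north steps in the columns of a path. -/
def columns (P : Path) : List ℕ := columnsAux 0 P

/-- The column list `L`, started at a lattice point of rank `r`, stays weakly above the
diagonal and ends on it. -/
def IsValid (m n : ℕ) : ℤ → List ℕ → Prop
  | r, [] => r = 0
  | r, x :: L => 0 ≤ r ∧ IsValid m n (r + m * x - n) L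

/-- The number of columns whose lowest point has rank less than `n`, starting from rank `r`. -/
def columnRet (m n : ℕ) : ℤ → List ℕ → ℕ
  | _, [] => 0
  | r, x :: L => (if r < n then 1 else 0) + columnRet m n (r + m * x - n) L

/-- The number of leading nonzero entries. -/
def columnRun : List ℕ → ℕ
  | [] => 0
  | x :: L => if x = 0 then 0 else columnRun L + 1

/-- The number of leading columns whose lowest point has rank less than `n`. -/
def forcedCount (m n : ℕ) : ℤ → List ℕ → ℕ
  | _, [] => 0
  | r, x :: L => if r < n then forcedCount m n (r + m * x - n) L + 1 else 0

/-- Move the block `x`, and then each block it meets, to the right as far as possible, until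
some block reaches a point of rank less than `n`. -/
def pushBlock (m n : ℕ) : ℤ → ℕ → List ℕ → List ℕ
  | _, x, [] => [x]
  | r, x, y :: L =>
    if r < n then x :: y :: L
    else if y = 0 then 0 :: pushBlock m n (r - n) x L
    else x :: pushBlock m n (r + m * x - n) y L

/-- The inverse of `pushBlock`. -/
def pullBlock (m n : ℕ) : ℤ → List ℕ → List ℕ
  | _, [] => []
  | r, z :: L =>
    if z = 0 then
      match pullBlock m n (r - n) L with
      | [] => [0]
      | x :: K => x :: 0 :: K
    else if r < n then z :: L
    else z :: pullBlock m n (r + m * z - n) L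

/-- Skip the leading forced columns and apply `pushBlock`. -/
def push (m n : ℕ) : ℤ → List ℕ → List ℕ
  | _, [] => []
  | r, x :: L => if r < n then x :: push m n (r + m * x - n) L else pushBlock m n r x L

/-- Skip the leading forced columns and apply `pullBlock`. -/
def pull (m n : ℕ) : ℤ → List ℕ → List ℕ
  | _, [] => []
  | r, x :: L => if r < n then x :: pull m n (r + m * x - n) L else pullBlock m n r (x :: L)

lemma IsValid.nonneg {m n : ℕ} {r : ℤ} {L : List ℕ} (h : IsValid m n r L) : 0 ≤ r := by
  cases L with
  | nil => exact le_of_eq (Eq.symm h)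
  | cons x L => exact h.1

lemma le_mul_of_pos {m n x : ℕ} (hmn : n < m) (hx : 0 < x) : (n : ℤ) < m * x := by
  have : n < m * x := lt_of_lt_of_le hmn (Nat.le_mul_of_pos_right m hx)
  exact_mod_cast this

lemma pushBlock_spec {m n : ℕ} (hmn : n < m) (L : List ℕ) :
    ∀ (r : ℤ) (x : ℕ), 0 < x → IsValid m n r (x :: L) →
      IsValid m n r (pushBlock m n r x L) ∧
      columnRet m n r (pushBlock m n r x L) = columnRet m n (r + m * x - n) L + 1 ∧
      (n ≤ r → columnRun (pushBlock m n r x L) + 1 = columnRun (x :: L)) ∧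
      pullBlock m n r (pushBlock m n r x L) = x :: L ∧
      (pushBlock m n r x L).length = L.length + 1 ∧
      (pushBlock m n r x L).filter (· ≠ 0) = (x :: L).filter (· ≠ 0) := by
  induction L with
  | nil =>
    intro r x hx h
    have h1 := h.1
    have h2 : r + m * x - n = 0 := h.2
    have := le_mul_of_pos hmn hx
    omega
  | cons y L ih =>
    intro r x hx h
    obtain ⟨hr, hr', hv⟩ := h
    have hmx := le_mul_of_pos hmn hx
    have hx0 : x ≠ 0 := hx.ne'
    by_cases hf : r < n
    · simp only [pushBlock, hf, if_true]
      refine ⟨⟨hr, hr', hv⟩, ?_, ?_, ?_, ?_, trivial⟩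
      · simp [columnRet, hf]; omega
      · intro h; omega
      · simp [pullBlock, hx0, hf]
      · simp
    · have hf' : ¬ (r + m * x - n < (n : ℤ)) := by omega
      by_cases hy : y = 0
      · subst hy
        simp only [pushBlock, hf, if_false, if_true]
        have e : r - n + m * x - n = r + m * x - n + m * (0 : ℕ) - n := by
          push_cast; ring
        obtain ⟨h1, h2, -, h4, h5, h6⟩ := ih (r - n) x hx ⟨by omega, by rw [e]; exact hv⟩
        have e2 : r + m * (0 : ℕ) - n = r - n := by push_cast; ring
        refine ⟨⟨hr, by rw [e2]; exact h1⟩, ?_, ?_, ?_, ?_, ?_⟩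
        · simp only [columnRet, hf, hf', if_false, e2, h2, e]; omega
        · intro _; simp [columnRun, hx0]
        · simp [pullBlock, h4]
        · simp [h5]
        · rw [List.filter_cons_of_neg (by simp), h6]
          simp [List.filter_cons]
      · simp only [pushBlock, hf, hy, if_false]
        obtain ⟨h1, h2, h3, h4, h5, h6⟩ :=
          ih (r + m * x - n) y (Nat.pos_of_ne_zero hy) ⟨hr', hv⟩
        refine ⟨⟨hr, h1⟩, ?_, ?_, ?_, ?_, ?_⟩
        · simp only [columnRet, hf, hf', if_false, h2]; omega
        · intro _
          have := h3 (by omega)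
          simp only [columnRun, hx0, if_false] at this ⊢
          omega
        · simp [pullBlock, hx0, hf, h4]
        · simp [h5]
        · rw [List.filter_cons, h6, List.filter_cons (x := x)]

lemma pullBlock_spec {m n : ℕ} (hmn : n < m) (L : List ℕ) :
    ∀ r : ℤ, IsValid m n r L → 0 < columnRet m n r L →
      ∃ x K, 0 < x ∧ IsValid m n r (x :: K) ∧ pullBlock m n r L = x :: K ∧
        pushBlock m n r x K = L := by
  induction L with
  | nil => intro r _ h; simp [columnRet] at h
  | cons z L ih =>
    intro r ⟨hr, hv⟩ hret
    by_cases hz : z = 0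
    · subst hz
      have e2 : r + m * (0 : ℕ) - n = r - n := by push_cast; ring
      rw [e2] at hv
      have hrn := hv.nonneg
      have hf : ¬ r < n := by omega
      simp only [columnRet, hf, if_false, e2, zero_add] at hret
      obtain ⟨x, K, hx, ⟨-, hK⟩, hpull, hpush⟩ := ih _ hv hret
      have hmx := le_mul_of_pos hmn hx
      refine ⟨x, 0 :: K, hx, ⟨hr, by omega, ?_⟩, ?_, ?_⟩
      · convert hK using 1; push_cast; ring
      · simp [pullBlock, hpull]
      · simp [pushBlock, hf, hpush]
    · by_cases hf : r < n
      · refine ⟨z, L, Nat.pos_of_ne_zero hz, ⟨hr, hv⟩, by simp [pullBlock, hz, hf], ?_⟩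
        cases L <;> simp [pushBlock, hf]
      · simp only [columnRet, hf, if_false, zero_add] at hret
        obtain ⟨x, K, hx, hK, hpull, hpush⟩ := ih _ hv hret
        refine ⟨z, x :: K, Nat.pos_of_ne_zero hz, ⟨hr, hK⟩, ?_, ?_⟩
        · simp [pullBlock, hz, hf, hpull]
        · simp [pushBlock, hf, hx.ne', hpush]

lemma IsValid.head_ne_zero {m n : ℕ} {r : ℤ} {x : ℕ} {L : List ℕ}
    (h : IsValid m n r (x :: L)) (hr : r < n) : x ≠ 0 := by
  rintro rfl
  have := h.2.nonneg
  push_cast at this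
  omega

lemma forcedCount_eq_zero {m n : ℕ} {r : ℤ} (hr : ¬ r < n) (L : List ℕ) :
    forcedCount m n r L = 0 := by
  cases L <;> simp [forcedCount, hr]

lemma forcedCount_le_columnRet (m n : ℕ) (L : List ℕ) :
    ∀ r, forcedCount m n r L ≤ columnRet m n r L := by
  induction L with
  | nil => intro r; simp [forcedCount]
  | cons x L ih =>
    intro r
    have := ih (r + m * x - n)
    by_cases hf : r < n <;> simp only [forcedCount, columnRet, hf, if_true, if_false] <;> omega

lemma forcedCount_le_columnRun {m n : ℕ} (L : List ℕ) :
    ∀ r, IsValid m n r L → forcedCount m n r L ≤ columnRun L := by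
  induction L with
  | nil => intro r _; simp [forcedCount]
  | cons x L ih =>
    intro r h
    by_cases hf : r < n
    · have := ih _ h.2
      simp only [forcedCount, columnRun, hf, h.head_ne_zero hf, if_true, if_false]
      omega
    · simp [forcedCount, hf]

lemma push_spec {m n : ℕ} (hmn : n < m) (L : List ℕ) :
    ∀ r : ℤ, IsValid m n r L → forcedCount m n r L < columnRun L →
      IsValid m n r (push m n r L) ∧
      forcedCount m n r (push m n r L) = forcedCount m n r L ∧
      columnRun (push m n r L) + 1 = columnRun L ∧
      columnRet m n r (push m n r L) = columnRet m n r L + 1 ∧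
      pull m n r (push m n r L) = L ∧
      (push m n r L).length = L.length ∧
      (push m n r L).filter (· ≠ 0) = L.filter (· ≠ 0) := by
  induction L with
  | nil => intro r _ h; simp [columnRun] at h
  | cons x L ih =>
    intro r h hrun
    by_cases hf : r < n
    · have hx := h.head_ne_zero hf
      simp only [forcedCount, columnRun, hf, hx, if_true, if_false] at hrun
      obtain ⟨h1, h2, h3, h4, h5, h6, h7⟩ := ih _ h.2 (by omega)
      simp only [push, hf, if_true]
      refine ⟨⟨h.1, h1⟩, ?_, ?_, ?_, ?_, ?_, ?_⟩
      · simp [forcedCount, h2]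
      · simp [columnRun, hx, h3]
      · simp only [columnRet, h4]; omega
      · simp [pull, hf, h5]
      · simp [h6]
      · rw [List.filter_cons, h7, List.filter_cons]
    · have hx : 0 < x := by
        rw [forcedCount_eq_zero hf] at hrun
        rcases Nat.eq_zero_or_pos x with rfl | hx
        · simp [columnRun] at hrun
        · exact hx
      obtain ⟨h1, h2, h3, h4, h5, h6⟩ := pushBlock_spec hmn L r x hx h
      simp only [push, hf, if_false]
      refine ⟨h1, ?_, h3 (by omega), ?_, ?_, h5, h6⟩
      · rw [forcedCount_eq_zero hf, forcedCount_eq_zero hf]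
      · simp [h2, columnRet, hf]
      · rw [← h4]
        cases hK : pushBlock m n r x L with
        | nil => simp [hK] at h5
        | cons y K => simp [pull, hf]

lemma pull_spec {m n : ℕ} (hmn : n < m) (L : List ℕ) :
    ∀ r : ℤ, IsValid m n r L → forcedCount m n r L < columnRet m n r L →
      IsValid m n r (pull m n r L) ∧
      forcedCount m n r (pull m n r L) = forcedCount m n r L ∧
      columnRun (pull m n r L) = columnRun L + 1 ∧
      columnRet m n r (pull m n r L) + 1 = columnRet m n r L ∧
      push m n r (pull m n r L) = L ∧
      (pull m n r L).length = L.length ∧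
      (pull m n r L).filter (· ≠ 0) = L.filter (· ≠ 0) := by
  induction L with
  | nil => intro r _ h; simp [columnRet] at h
  | cons x L ih =>
    intro r h hret
    by_cases hf : r < n
    · have hx := h.head_ne_zero hf
      simp only [forcedCount, columnRet, hf, if_true] at hret
      obtain ⟨h1, h2, h3, h4, h5, h6, h7⟩ := ih _ h.2 (by omega)
      simp only [pull, hf, if_true]
      refine ⟨⟨h.1, h1⟩, ?_, ?_, ?_, ?_, ?_, ?_⟩
      · simp [forcedCount, h2]
      · simp [columnRun, hx, h3]
      · simp only [columnRet]; omega
      · simp [push, hf, h5]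
      · simp [h6]
      · rw [List.filter_cons, h7, List.filter_cons]
    · rw [forcedCount_eq_zero hf] at hret
      obtain ⟨z, K, hz, hK, hpull, hpush⟩ := pullBlock_spec hmn _ r h hret
      obtain ⟨h1, h2, h3, h4, h5, h6⟩ := pushBlock_spec hmn K r z hz hK
      rw [hpush] at h2 h3 h5 h6
      simp only [pull, hf, if_false, hpull]
      refine ⟨hK, ?_, (h3 (by omega)).symm, ?_, ?_, by simp [h5], h6.symm⟩
      · rw [forcedCount_eq_zero hf, forcedCount_eq_zero hf]
      · rw [h2]; simp [columnRet, hf]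
      · simp [push, hf, hpush]

lemma push_iterate_spec {m n : ℕ} (hmn : n < m) (k : ℕ) :
    ∀ (r : ℤ) (L : List ℕ), IsValid m n r L → forcedCount m n r L + k ≤ columnRun L →
      IsValid m n r ((push m n r)^[k] L) ∧
      columnRun ((push m n r)^[k] L) + k = columnRun L ∧
      columnRet m n r ((push m n r)^[k] L) = columnRet m n r L + k ∧
      (pull m n r)^[k] ((push m n r)^[k] L) = L ∧
      ((push m n r)^[k] L).length = L.length ∧
      ((push m n r)^[k] L).filter (· ≠ 0) = L.filter (· ≠ 0) := by
  induction k with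
  | zero => intro r L h _; exact ⟨h, rfl, rfl, rfl, rfl, rfl⟩
  | succ k ih =>
    intro r L h hk
    obtain ⟨h1, h2, h3, h4, h5, h6, h7⟩ := push_spec hmn L r h (by omega)
    obtain ⟨g1, g3, g4, g5, g6, g7⟩ := ih r (push m n r L) h1 (by omega)
    rw [Function.iterate_succ_apply (push m n r)]
    refine ⟨g1, by omega, by omega, ?_, g6.trans h6, g7.trans h7⟩
    rw [Function.iterate_succ_apply' (pull m n r), g5, h5]

lemma pull_iterate_spec {m n : ℕ} (hmn : n < m) (k : ℕ) :
    ∀ (r : ℤ) (L : List ℕ), IsValid m n r L → forcedCount m n r L + k ≤ columnRet m n r L →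
      IsValid m n r ((pull m n r)^[k] L) ∧
      columnRun ((pull m n r)^[k] L) = columnRun L + k ∧
      columnRet m n r ((pull m n r)^[k] L) + k = columnRet m n r L ∧
      (push m n r)^[k] ((pull m n r)^[k] L) = L ∧
      ((pull m n r)^[k] L).length = L.length ∧
      ((pull m n r)^[k] L).filter (· ≠ 0) = L.filter (· ≠ 0) := by
  induction k with
  | zero => intro r L h _; exact ⟨h, rfl, rfl, rfl, rfl, rfl⟩
  | succ k ih =>
    intro r L h hk
    obtain ⟨h1, h2, h3, h4, h5, h6, h7⟩ := pull_spec hmn L r h (by omega)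
    obtain ⟨g1, g3, g4, g5, g6, g7⟩ := ih r (pull m n r L) h1 (by omega)
    rw [Function.iterate_succ_apply (pull m n r)]
    refine ⟨g1, by omega, by omega, ?_, g6.trans h6, g7.trans h7⟩
    rw [Function.iterate_succ_apply' (push m n r), g5, h5]

/-- The involution on column lists exchanging `columnRun` and `columnRet`. -/
def columnSwap (m n : ℕ) (L : List ℕ) : List ℕ :=
  if columnRet m n 0 L ≤ columnRun L then
    (push m n 0)^[columnRun L - columnRet m n 0 L] L
  else (pull m n 0)^[columnRet m n 0 L - columnRun L] L

lemma columnSwap_spec {m n : ℕ} (hmn : n < m) {L : List ℕ} (h : IsValid m n 0 L) :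
    IsValid m n 0 (columnSwap m n L) ∧
    columnRun (columnSwap m n L) = columnRet m n 0 L ∧
    columnRet m n 0 (columnSwap m n L) = columnRun L ∧
    columnSwap m n (columnSwap m n L) = L ∧
    (columnSwap m n L).length = L.length ∧
    (columnSwap m n L).filter (· ≠ 0) = L.filter (· ≠ 0) := by
  have hrun := forcedCount_le_columnRun L 0 h
  have hret := forcedCount_le_columnRet m n L 0
  by_cases hc : columnRet m n 0 L ≤ columnRun L
  · obtain ⟨h1, h2, h3, h4, h5, h6⟩ :=
      push_iterate_spec hmn (columnRun L - columnRet m n 0 L) 0 L h (by omega)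
    have e : columnSwap m n L = (push m n 0)^[columnRun L - columnRet m n 0 L] L := if_pos hc
    rw [← e] at h1 h2 h3 h4 h5 h6
    have e1 : columnRun (columnSwap m n L) = columnRet m n 0 L := by omega
    have e2 : columnRet m n 0 (columnSwap m n L) = columnRun L := by omega
    refine ⟨h1, e1, e2, ?_, h5, h6⟩
    rcases hc.eq_or_lt with heq | hlt
    · have e3 : columnSwap m n L = L := by rw [e, heq, Nat.sub_self]; rfl
      rw [e3, e3]
    · rw [columnSwap, if_neg (by omega), e1, e2, h4]
  · obtain ⟨h1, h2, h3, h4, h5, h6⟩ :=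
      pull_iterate_spec hmn (columnRet m n 0 L - columnRun L) 0 L h (by omega)
    have e : columnSwap m n L = (pull m n 0)^[columnRet m n 0 L - columnRun L] L := if_neg hc
    rw [← e] at h1 h2 h3 h4 h5 h6
    have e1 : columnRun (columnSwap m n L) = columnRet m n 0 L := by omega
    have e2 : columnRet m n 0 (columnSwap m n L) = columnRun L := by omega
    refine ⟨h1, e1, e2, ?_, h5, h6⟩
    rw [columnSwap, if_pos (by omega), e1, e2, h4]

lemma ofColumns_cons (x : ℕ) (L : List ℕ) :
    ofColumns (x :: L) = List.replicate x true ++ false :: ofColumns L := by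
  simp [ofColumns]

lemma columnsAux_replicate_append (x : ℕ) (P : Path) :
    ∀ k, columnsAux k (List.replicate x true ++ P) = columnsAux (k + x) P := by
  induction x with
  | zero => simp
  | succ x ih =>
    intro k
    rw [List.replicate_succ, List.cons_append, columnsAux, ih]
    congr 1; omega

lemma columns_ofColumns (L : List ℕ) : columns (ofColumns L) = L := by
  induction L with
  | nil => rfl
  | cons x L ih =>
    rw [columns] at ih
    rw [columns, ofColumns_cons, columnsAux_replicate_append, columnsAux, ih, zero_add]

lemma exists_eq_ofColumns_columnsAux (P : Path) :
    ∀ k, ∃ j, List.replicate k true ++ P =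
      ofColumns (columnsAux k P) ++ List.replicate j true := by
  induction P with
  | nil => intro k; exact ⟨k, by simp [columnsAux, ofColumns]⟩
  | cons b P ih =>
    intro k
    cases b with
    | true =>
      obtain ⟨j, hj⟩ := ih (k + 1)
      refine ⟨j, ?_⟩
      rw [columnsAux, ← hj, List.replicate_succ']
      simp
    | false =>
      obtain ⟨j, hj⟩ := ih 0
      refine ⟨j, ?_⟩
      rw [columnsAux, ofColumns_cons, List.append_assoc, List.cons_append, ← hj]
      simp

lemma count_false_ofColumns (L : List ℕ) : (ofColumns L).count false = L.length := by
  induction L with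
  | nil => rfl
  | cons x L ih => simp [ofColumns_cons, List.count_replicate, ih]

lemma count_true_ofColumns (L : List ℕ) : (ofColumns L).count true = L.sum := by
  induction L with
  | nil => rfl
  | cons x L ih => simp [ofColumns_cons, ih]

lemma prefRank_true_cons (m n : ℕ) (P : Path) :
    prefRank m n (true :: P) = m + prefRank m n P := by
  simp [prefRank]; ring

lemma prefRank_false_cons (m n : ℕ) (P : Path) :
    prefRank m n (false :: P) = -n + prefRank m n P := by
  simp [prefRank]; ring

/-- All points of `P` have nonnegative rank when `P` starts at a point of rank `r`. -/
def StaysAbove (m n : ℕ) (r : ℤ) (P : Path) : Prop :=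
  ∀ i ≤ P.length, 0 ≤ r + prefRank m n (P.take i)

lemma staysAbove_true_cons (m n : ℕ) (r : ℤ) (P : Path) :
    StaysAbove m n r (true :: P) ↔ 0 ≤ r ∧ StaysAbove m n (r + m) P := by
  constructor
  · intro h
    refine ⟨by simpa [prefRank] using h 0 (by simp), fun i hi => ?_⟩
    have := h (i + 1) (by simpa using hi)
    rwa [List.take_succ_cons, prefRank_true_cons, ← add_assoc] at this
  · rintro ⟨h0, h⟩ i hi
    cases i with
    | zero => simpa [prefRank] using h0
    | succ i =>
      rw [List.take_succ_cons, prefRank_true_cons, ← add_assoc]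
      exact h i (by simpa using hi)

lemma staysAbove_false_cons (m n : ℕ) (r : ℤ) (P : Path) :
    StaysAbove m n r (false :: P) ↔ 0 ≤ r ∧ StaysAbove m n (r - n) P := by
  constructor
  · intro h
    refine ⟨by simpa [prefRank] using h 0 (by simp), fun i hi => ?_⟩
    have := h (i + 1) (by simpa using hi)
    rwa [List.take_succ_cons, prefRank_false_cons, ← add_assoc] at this
  · rintro ⟨h0, h⟩ i hi
    cases i with
    | zero => simpa [prefRank] using h0
    | succ i =>
      rw [List.take_succ_cons, prefRank_false_cons, ← add_assoc]
      exact h i (by simpa using hi)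

lemma staysAbove_column (m n x : ℕ) (P : Path) :
    ∀ r : ℤ, StaysAbove m n r (List.replicate x true ++ false :: P) ↔
      0 ≤ r ∧ StaysAbove m n (r + m * x - n) P := by
  induction x with
  | zero => intro r; simp [staysAbove_false_cons]
  | succ x ih =>
    intro r
    rw [List.replicate_succ, List.cons_append, staysAbove_true_cons, ih]
    have e : r + m + m * x - n = r + m * ((x + 1 : ℕ) : ℤ) - n := by push_cast; ring
    rw [e]
    constructor
    · rintro ⟨h1, -, h3⟩; exact ⟨h1, h3⟩
    · rintro ⟨h1, h3⟩; exact ⟨h1, by omega, h3⟩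

lemma isValid_iff (m n : ℕ) (L : List ℕ) :
    ∀ r : ℤ, IsValid m n r L ↔
      StaysAbove m n r (ofColumns L) ∧ r + m * L.sum - n * L.length = 0 := by
  induction L with
  | nil =>
    intro r
    constructor
    · rintro rfl
      exact ⟨fun i _ => by simp [ofColumns, prefRank], by simp⟩
    · rintro ⟨-, h⟩
      simpa [IsValid] using h
  | cons x L ih =>
    intro r
    rw [IsValid, ih, ofColumns_cons, staysAbove_column, and_assoc]
    have e : r + m * x - n + m * L.sum - n * L.length =
        r + m * ((x :: L).sum : ℕ) - n * ((x :: L).length : ℕ) := by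
      push_cast [List.sum_cons, List.length_cons]; ring
    rw [e]

lemma isDyck_ofColumns_iff {m n : ℕ} (hmn : n < m) (L : List ℕ) :
    IsDyck m n (ofColumns L) ↔ L.length = m ∧ IsValid m n 0 L := by
  rw [IsDyck, count_false_ofColumns, count_true_ofColumns, isValid_iff]
  constructor
  · rintro ⟨h1, h2, h3⟩
    refine ⟨h1, fun i hi => by simpa using h3 i hi, ?_⟩
    rw [h1, h2]; ring
  · rintro ⟨h1, h3, h4⟩
    refine ⟨h1, ?_, fun i hi => by simpa using h3 i hi⟩
    rw [h1] at h4
    have hm : (m : ℤ) ≠ 0 := by omega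
    have : (m : ℤ) * L.sum = m * n := by linarith
    exact_mod_cast mul_left_cancel₀ hm this

lemma IsDyck.ofColumns_columns {m n : ℕ} (hmn : n < m) {P : Path} (h : IsDyck m n P) :
    ofColumns (columns P) = P := by
  obtain ⟨j, hj⟩ := exists_eq_ofColumns_columnsAux P 0
  rw [List.replicate_zero, List.nil_append] at hj
  obtain ⟨h1, h2, h3⟩ := h
  have hle : (ofColumns (columnsAux 0 P)).length ≤ P.length := by
    rw [congrArg List.length hj, List.length_append]; omega
  have h4 := h3 _ hle
  have e : P.take (ofColumns (columnsAux 0 P)).length = ofColumns (columnsAux 0 P) := by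
    conv_lhs => rw [hj]
    rw [List.take_left']
    rw [← hj]
  rw [e, prefRank] at h4
  have c1 : P.count false = (ofColumns (columnsAux 0 P)).count false := by
    rw [congrArg (List.count false) hj]; simp [List.count_replicate]
  have c2 : P.count true = (ofColumns (columnsAux 0 P)).count true + j := by
    rw [congrArg (List.count true) hj]; simp
  have c3 : ((ofColumns (columnsAux 0 P)).count true : ℤ) = n - j := by omega
  rw [← c1, h1, c3] at h4
  have hj0 : j = 0 := by
    by_contra hne
    have : (1 : ℤ) ≤ j := by omega
    nlinarith
  rw [hj0, List.replicate_zero, List.append_nil] at hj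
  exact hj.symm

/-- The number of points of rank less than `n` on `P`, apart from the last one, when `P`
starts at a point of rank `r`. -/
def lowCount (m n : ℕ) (r : ℤ) (P : Path) : ℕ :=
  ((List.range P.length).filter fun i => r + prefRank m n (P.take i) < (n : ℤ)).length

lemma lowCount_true_cons (m n : ℕ) (r : ℤ) (P : Path) :
    lowCount m n r (true :: P) = (if r < n then 1 else 0) + lowCount m n (r + m) P := by
  simp only [lowCount, List.length_cons, List.range_succ_eq_map, List.filter_cons,
    List.filter_map, Function.comp_def, List.take_succ_cons,
    prefRank_true_cons, ← add_assoc]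
  by_cases h : r < n <;> simp [h, prefRank, add_comm]

lemma lowCount_false_cons (m n : ℕ) (r : ℤ) (P : Path) :
    lowCount m n r (false :: P) = (if r < n then 1 else 0) + lowCount m n (r - n) P := by
  simp only [lowCount, List.length_cons, List.range_succ_eq_map, List.filter_cons,
    List.filter_map, Function.comp_def, List.take_succ_cons,
    prefRank_false_cons, ← add_assoc, ← sub_eq_add_neg]
  by_cases h : r < n <;> simp [h, prefRank, add_comm]

lemma lowCount_column {m n : ℕ} (hmn : n < m) (x : ℕ) (P : Path) :
    ∀ r : ℤ, 0 ≤ r → lowCount m n r (List.replicate x true ++ false :: P) =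
      (if r < n then 1 else 0) + lowCount m n (r + m * x - n) P := by
  induction x with
  | zero => intro r _; simp [lowCount_false_cons]
  | succ x ih =>
    intro r hr
    rw [List.replicate_succ, List.cons_append, lowCount_true_cons, ih _ (by omega),
      if_neg (show ¬ r + m < (n : ℤ) by omega), zero_add]
    congr 2
    push_cast; ring

lemma lowCount_ofColumns {m n : ℕ} (hmn : n < m) (L : List ℕ) :
    ∀ r, IsValid m n r L → lowCount m n r (ofColumns L) = columnRet m n r L := by
  induction L with
  | nil => intro r _; rfl
  | cons x L ih =>
    intro r h
    rw [ofColumns_cons, lowCount_column hmn _ _ _ h.1, ih _ h.2, columnRet]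

lemma retStat_ofColumns {m n : ℕ} (hmn : n < m) {L : List ℕ} (h : IsValid m n 0 L) :
    retStat m n (ofColumns L) = columnRet m n 0 L := by
  rw [← lowCount_ofColumns hmn L 0 h, retStat, lowCount]
  simp

lemma mem_coarea_cons (b : Bool) (P : Path) (i : ℕ) :
    i ∈ coarea (b :: P) ↔ (b = true ∧ i = 0) ∨
      ∃ k ∈ coarea P, i = k + if b = true then 0 else 1 := by
  simp only [coarea, List.mem_filterMap, List.mem_range, List.length_cons]
  constructor
  · rintro ⟨j, hj, h⟩
    cases j with
    | zero => cases b <;> simp_all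
    | succ j =>
      right
      refine ⟨(P.take j).count false, ⟨j, by omega, ?_⟩, ?_⟩
      · cases b <;> by_cases hP : P.getD j false = true <;> simp_all
      · cases b <;> by_cases hP : P.getD j false = true <;> simp_all
  · rintro (⟨rfl, rfl⟩ | ⟨k, ⟨j, hj, h⟩, rfl⟩)
    · exact ⟨0, by omega, by simp⟩
    · refine ⟨j + 1, by omega, ?_⟩
      cases b <;> by_cases hP : P.getD j false = true <;> simp_all

lemma mem_coarea_column (x : ℕ) (P : Path) (i : ℕ) :
    i ∈ coarea (List.replicate x true ++ false :: P) ↔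
      (x ≠ 0 ∧ i = 0) ∨ ∃ k ∈ coarea P, i = k + 1 := by
  induction x with
  | zero => simp [mem_coarea_cons]
  | succ x ih =>
    rw [List.replicate_succ, List.cons_append, mem_coarea_cons]
    simp only [if_true, add_zero, exists_eq_right', true_and]
    rw [ih]
    simp only [ne_eq, Nat.add_eq_zero_iff, one_ne_zero, and_false, not_false_eq_true, true_and]
    tauto

lemma mem_coarea_ofColumns (L : List ℕ) : ∀ i, i ∈ coarea (ofColumns L) ↔ L.getD i 0 ≠ 0 := by
  induction L with
  | nil => intro i; simp [ofColumns, coarea]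
  | cons x L ih =>
    intro i
    rw [ofColumns_cons, mem_coarea_column]
    cases i with
    | zero => simp
    | succ i => simp [ih]

lemma getD_columnRun (L : List ℕ) : L.getD (columnRun L) 0 = 0 := by
  induction L with
  | nil => rfl
  | cons x L ih => by_cases hx : x = 0 <;> simp_all [columnRun]

lemma getD_ne_zero_of_lt_columnRun (L : List ℕ) : ∀ i < columnRun L, L.getD i 0 ≠ 0 := by
  induction L with
  | nil => intro i hi; simp [columnRun] at hi
  | cons x L ih =>
    intro i hi
    by_cases hx : x = 0
    · simp [columnRun, hx] at hi
    · cases i with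
      | zero => simpa using hx
      | succ i => simpa using ih i (by simpa [columnRun, hx] using hi)

lemma columnRun_le_sum (L : List ℕ) : columnRun L ≤ L.sum := by
  induction L with
  | nil => simp [columnRun]
  | cons x L ih =>
    by_cases hx : x = 0
    · simp [columnRun, hx]
    · simp only [columnRun, hx, if_false, List.sum_cons]; omega

lemma runStat_ofColumns {L : List ℕ} (h : 0 < columnRun L) :
    runStat (ofColumns L) = columnRun L := by
  have hl : IsLeast {i : ℕ | 1 ≤ i ∧ i ≤ (ofColumns L).count true ∧ i ∉ coarea (ofColumns L)}
      (columnRun L) := by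
    refine ⟨⟨h, ?_, ?_⟩, ?_⟩
    · rw [count_true_ofColumns]; exact columnRun_le_sum L
    · simpa only [mem_coarea_ofColumns, not_not] using getD_columnRun L
    · rintro i ⟨-, -, hi⟩
      by_contra hlt
      exact hi ((mem_coarea_ofColumns L i).2 (getD_ne_zero_of_lt_columnRun L i (not_le.1 hlt)))
  exact hl.csInf_eq

lemma splitOn_column (x : ℕ) (P : Path) :
    (List.replicate x true ++ false :: P).splitOn false =
      List.replicate x true :: P.splitOn false := by
  rw [List.splitOn_eq_splitOnP, List.splitOn_eq_splitOnP,
    List.splitOnP_append_cons_of_forall_mem]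
  · intro b hb
    simp [List.eq_of_mem_replicate hb]
  · simp

lemma compType_ofColumns (L : List ℕ) : compType (ofColumns L) = L.filter (· ≠ 0) := by
  induction L with
  | nil => rfl
  | cons x L ih =>
    rw [compType] at ih
    rw [compType, ofColumns_cons, splitOn_column, List.map_cons, List.filter_cons, ih,
      List.length_replicate, List.filter_cons]

lemma columnRun_pos {m n : ℕ} (hn : 0 < n) {L : List ℕ} (hL : L.length ≠ 0)
    (h : IsValid m n 0 L) : 0 < columnRun L := by
  cases L with
  | nil => simp at hL
  | cons x L =>
    have := h.head_ne_zero (by exact_mod_cast hn)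
    simp [columnRun, this]

/-- For `m > n` there is a composition-type preserving involution `Φ` on
`D_{m,n}` exchanging the statistics `run` and `ret`. -/
theorem run_ret_involution (m n : ℕ) (hn : 0 < n) (hmn : n < m) :
    ∃ Φ : Path → Path,
      (∀ P : Path, IsDyck m n P → IsDyck m n (Φ P)) ∧
      (∀ P : Path, IsDyck m n P → Φ (Φ P) = P) ∧
      (∀ P : Path, IsDyck m n P →
        compType (Φ P) = compType P ∧
        runStat (Φ P) = retStat m n P ∧
        retStat m n (Φ P) = runStat P) := by
  have key : ∀ P, IsDyck m n P → ∃ L, P = ofColumns L ∧ L.length = m ∧ IsValid m n 0 L := by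
    intro P h
    have e := h.ofColumns_columns hmn
    exact ⟨columns P, e.symm, (isDyck_ofColumns_iff hmn _).1 (by rwa [e])⟩
  refine ⟨fun P => ofColumns (columnSwap m n (columns P)), ?_, ?_, ?_⟩
  · intro P h
    obtain ⟨L, rfl, hL, hv⟩ := key P h
    obtain ⟨h1, -, -, -, h5, -⟩ := columnSwap_spec hmn hv
    simp only [columns_ofColumns]
    exact (isDyck_ofColumns_iff hmn _).2 ⟨h5.trans hL, h1⟩
  · intro P h
    obtain ⟨L, rfl, hL, hv⟩ := key P h
    simp only [columns_ofColumns, (columnSwap_spec hmn hv).2.2.2.1]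
  · intro P h
    obtain ⟨L, rfl, hL, hv⟩ := key P h
    obtain ⟨h1, h2, h3, -, h5, h6⟩ := columnSwap_spec hmn hv
    simp only [columns_ofColumns, compType_ofColumns, retStat_ofColumns hmn hv,
      retStat_ofColumns hmn h1, runStat_ofColumns (columnRun_pos hn (by omega) hv),
      runStat_ofColumns (columnRun_pos hn (by omega) h1), h2, h3, and_true]
    exact h6

end RationalDyck
end

section
/- Let m > n be positive integers, let α = (α_1,…,α_ℓ) be a composition of n, and set r = rr(α,m). Then for all non-negative integers a ≤ b, the sets D_{m,α}^{(r+a, r+b−a)} and D_{m,α}^{(r+b, r)} have the same cardinality. -/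
open scoped Classical

namespace RationalDyck

/-- `P` is a path suffix starting at rank `ρ` that never drops below rank `0`
and ends at rank `0`. -/
def IsSuffix (m n : ℕ) : ℕ → Path → Prop
  | ρ, [] => ρ = 0
  | ρ, true :: P => IsSuffix m n (ρ + m) P
  | ρ, false :: P => n ≤ ρ ∧ IsSuffix m n (ρ - n) P

/-- The number of points of rank less than `n`, other than the last one,
on a path suffix starting at rank `ρ`. -/
def touches (m n : ℕ) : ℕ → Path → ℕ
  | _, [] => 0
  | ρ, true :: P => (if ρ < n then 1 else 0) + touches m n (ρ + m) P
  | ρ, false :: P => (if ρ < n then 1 else 0) + touches m n (ρ - n) P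

/-- A block of `a` north steps, an east step, and then `P`. -/
def block (a : ℕ) (P : Path) : Path := List.replicate a true ++ false :: P

theorem block_induction {p : Path → Prop} (h₀ : ∀ a, p (List.replicate a true))
    (h₁ : ∀ a P, p P → p (block a P)) (P : Path) : p P := by
  suffices h : ∀ a, p (List.replicate a true ++ P) by simpa using h 0
  induction P with
  | nil => simpa using h₀
  | cons s P ih =>
    intro a
    cases s with
    | false => exact h₁ a P (by simpa using ih 0)
    | true =>
      have h := ih (a + 1)
      rwa [List.replicate_succ', List.append_assoc] at h

theorem block_injective (a : ℕ) : Function.Injective (block a) := by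
  intro P Q h
  simpa [block] using h

theorem compType_replicate (a : ℕ) :
    compType (List.replicate a true) = if a = 0 then [] else [a] := by
  have h : (List.replicate a true).splitOn false = [List.replicate a true] :=
    List.splitOnP_eq_singleton (by simp)
  unfold compType
  rw [h]
  by_cases ha : a = 0 <;> simp [ha]

theorem compType_block (a : ℕ) (P : Path) :
    compType (block a P) = if a = 0 then compType P else a :: compType P := by
  have h : (block a P).splitOn false = List.replicate a true :: P.splitOn false :=
    List.splitOnP_append_cons_of_forall_mem (by simp) _ (by simp) _
  unfold compType
  rw [h]
  by_cases ha : a = 0 <;> simp [ha]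

theorem sum_compType (P : Path) : (compType P).sum = P.count true := by
  induction P using block_induction with
  | h₀ a => rw [compType_replicate]; by_cases ha : a = 0 <;> simp [ha]
  | h₁ a P ih =>
    rw [compType_block]
    by_cases ha : a = 0
    · simp [ha, ih, block]
    · simp [ha, ih, block]

theorem pos_of_mem_compType {P : Path} {a : ℕ} (h : a ∈ compType P) : 0 < a := by
  simp only [compType, List.mem_filter, decide_eq_true_eq] at h
  exact Nat.pos_of_ne_zero h.2

theorem mem_coarea {P : Path} {k : ℕ} :
    k ∈ coarea P ↔ ∃ i < P.length, P.getD i false = true ∧ (P.take i).count false = k := by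
  simp [coarea, List.mem_filterMap]

theorem mem_coarea_cons_s1 {s : Bool} {P : Path} {k : ℕ} :
    k ∈ coarea (s :: P) ↔ (s = true ∧ k = 0) ∨
      ∃ i < P.length, P.getD i false = true ∧ ((s :: P.take i).count false) = k := by
  rw [mem_coarea]
  constructor
  · rintro ⟨_ | i, hi, h⟩
    · exact Or.inl (by simpa [eq_comm] using h)
    · exact Or.inr ⟨i, by simpa using hi, by simpa using h⟩
  · rintro (h | ⟨i, hi, h⟩)
    · exact ⟨0, by simp, by simpa [eq_comm] using h⟩
    · exact ⟨i + 1, by simpa using hi, by simpa using h⟩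

theorem mem_coarea_cons_true {P : Path} {k : ℕ} :
    k ∈ coarea (true :: P) ↔ k = 0 ∨ k ∈ coarea P := by
  rw [mem_coarea_cons_s1, mem_coarea]
  simp

theorem mem_coarea_cons_false {P : Path} {k : ℕ} :
    k ∈ coarea (false :: P) ↔ ∃ j ∈ coarea P, j + 1 = k := by
  rw [mem_coarea_cons_s1]
  simp only [mem_coarea]
  constructor
  · rintro (⟨h, -⟩ | ⟨i, hi, h, h'⟩)
    · simp at h
    · exact ⟨_, ⟨i, hi, h, rfl⟩, by simpa using h'⟩
  · rintro ⟨_, ⟨i, hi, h, rfl⟩, h'⟩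
    exact Or.inr ⟨i, hi, h, by simpa using h'⟩

theorem zero_mem_coarea_block {a : ℕ} {P : Path} : 0 ∈ coarea (block a P) ↔ 0 < a := by
  induction a with
  | zero => simp [block, mem_coarea_cons_false]
  | succ a ih => simp [block, List.replicate_succ, mem_coarea_cons_true]

theorem succ_mem_coarea_block {a k : ℕ} {P : Path} :
    k + 1 ∈ coarea (block a P) ↔ k ∈ coarea P := by
  induction a with
  | zero => simp [block, mem_coarea_cons_false]
  | succ a ih => simpa [block, List.replicate_succ, mem_coarea_cons_true] using ih

theorem coarea_nil : coarea [] = [] := rfl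

section Suffix

variable {m n : ℕ}

theorem isSuffix_replicate {ρ a : ℕ} :
    IsSuffix m n ρ (List.replicate a true) ↔ ρ + a * m = 0 := by
  induction a generalizing ρ with
  | zero => simp [IsSuffix]
  | succ a ih => rw [List.replicate_succ, IsSuffix, ih]; ring_nf

theorem isSuffix_block {ρ a : ℕ} {P : Path} :
    IsSuffix m n ρ (block a P) ↔ n ≤ ρ + a * m ∧ IsSuffix m n (ρ + a * m - n) P := by
  induction a generalizing ρ with
  | zero => simp [block, IsSuffix]
  | succ a ih =>
    have : block (a + 1) P = true :: block a P := rfl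
    rw [this, IsSuffix, ih, show ρ + m + a * m = ρ + (a + 1) * m by ring]

theorem touches_block_of_le {ρ a : ℕ} {P : Path} (hρ : n ≤ ρ) :
    touches m n ρ (block a P) = touches m n (ρ + a * m - n) P := by
  induction a generalizing ρ with
  | zero => simp [block, touches, hρ.not_gt]
  | succ a ih =>
    have : block (a + 1) P = true :: block a P := rfl
    rw [this, touches, ih (by omega), show ρ + m + a * m = ρ + (a + 1) * m by ring]
    simp [hρ.not_gt]

theorem touches_block (hmn : n ≤ m) {ρ a : ℕ} {P : Path} (ha : 0 < a) :
    touches m n ρ (block a P) =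
      (if ρ < n then 1 else 0) + touches m n (ρ + a * m - n) P := by
  obtain ⟨a, rfl⟩ : ∃ b, a = b + 1 := ⟨a - 1, by omega⟩
  have : block (a + 1) P = true :: block a P := rfl
  rw [this, touches, touches_block_of_le (by omega),
    show ρ + m + a * m = ρ + (a + 1) * m by ring]

/-- The path suffixes from rank `ρ` of composition type `β` with `c` touches. -/
def suffixes (m n ρ : ℕ) (β : List ℕ) (c : ℕ) : Set Path :=
  {P | IsSuffix m n ρ P ∧ compType P = β ∧ touches m n ρ P = c}

/-- The path suffixes from rank `ρ` of composition type `β` with `c` touches whose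
coarea sequence contains `0, …, k - 1` but not `k`. -/
def runSuffixes (m n ρ : ℕ) (β : List ℕ) (k c : ℕ) : Set Path :=
  {P | P ∈ suffixes m n ρ β c ∧ (∀ i < k, i ∈ coarea P) ∧ k ∉ coarea P}

theorem eq_nil_or_exists_block (hm : 0 < m) {ρ : ℕ} {P : Path} (hP : IsSuffix m n ρ P) :
    (P = [] ∧ ρ = 0) ∨ ∃ a Q, P = block a Q := by
  induction P using block_induction with
  | h₀ a =>
    rw [isSuffix_replicate] at hP
    have : a = 0 := by
      rcases Nat.eq_zero_of_add_eq_zero_left hP with h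
      simpa [hm.ne'] using h
    subst this
    left
    simpa using hP
  | h₁ a P _ => exact Or.inr ⟨a, P, rfl⟩

theorem block_zero_mem_suffixes {ρ c : ℕ} {β : List ℕ} {P : Path} :
    block 0 P ∈ suffixes m n ρ β c ↔ n ≤ ρ ∧ P ∈ suffixes m n (ρ - n) β c := by
  by_cases h : n ≤ ρ
  · simp [suffixes, isSuffix_block, compType_block, h, touches_block_of_le]
  · simp [suffixes, isSuffix_block, h]

theorem block_mem_suffixes (hmn : n ≤ m) {ρ a b c : ℕ} {β : List ℕ} {P : Path} (ha : 0 < a) :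
    block a P ∈ suffixes m n ρ (b :: β) ((if ρ < n then 1 else 0) + c) ↔
      a = b ∧ P ∈ suffixes m n (ρ + a * m - n) β c := by
  have h : n ≤ ρ + a * m := by nlinarith
  simp only [suffixes, Set.mem_ofPred_eq, isSuffix_block, compType_block, h, ha.ne',
    touches_block hmn ha, if_false, List.cons.injEq, Nat.add_left_cancel_iff, true_and]
  tauto

theorem suffixes_nil_succ (ρ c : ℕ) :
    suffixes m n ρ [] (c + 1) = ∅ := by
  rw [Set.eq_empty_iff_forall_notMem]
  intro P hP
  induction P using block_induction generalizing ρ with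
  | h₀ a =>
    obtain ⟨-, h, h'⟩ := hP
    by_cases ha : a = 0
    · simp [ha, touches] at h'
    · simp [compType_replicate, ha] at h
  | h₁ a P ih =>
    by_cases ha : a = 0
    · subst ha
      exact ih _ (block_zero_mem_suffixes.1 hP).2
    · have h := hP.2.1
      simp [compType_block, ha] at h

theorem encard_suffixes_nil (hn : 0 < n) (hm : 0 < m) {ρ : ℕ} (hρ : n ≤ ρ) (c : ℕ) :
    (suffixes m n ρ [] c).encard = (suffixes m n (ρ - n) [] c).encard := by
  rw [← (block_injective 0).encard_image (suffixes m n (ρ - n) [] c)]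
  congr 1
  ext P
  constructor
  · intro hP
    rcases eq_nil_or_exists_block hm hP.1 with ⟨-, h⟩ | ⟨a, Q, rfl⟩
    · omega
    · by_cases ha : a = 0
      · subst ha
        exact ⟨Q, (block_zero_mem_suffixes.1 hP).2, rfl⟩
      · have h := hP.2.1
        simp [compType_block, ha] at h
  · rintro ⟨Q, hQ, rfl⟩
    exact block_zero_mem_suffixes.2 ⟨hρ, hQ⟩

theorem encard_suffixes_of_lt (hmn : n ≤ m) (hn : 0 < n) {ρ a : ℕ} (ha : 0 < a)
    (hρ : ρ < n) (β : List ℕ) (c : ℕ) :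
    (suffixes m n ρ (a :: β) (c + 1)).encard =
      (suffixes m n (ρ + a * m - n) β c).encard := by
  have key {b : ℕ} {Q : Path} (hb : 0 < b) :=
    block_mem_suffixes hmn (ρ := ρ) (b := a) (c := c) (β := β) (P := Q) hb
  simp only [hρ, if_true, add_comm 1 c] at key
  rw [← (block_injective a).encard_image (suffixes m n (ρ + a * m - n) β c)]
  congr 1
  ext P
  constructor
  · intro hP
    rcases eq_nil_or_exists_block (by omega) hP.1 with ⟨rfl, -⟩ | ⟨b, Q, rfl⟩
    · simpa [compType] using hP.2.1
    · rcases Nat.eq_zero_or_pos b with rfl | hb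
      · have := (block_zero_mem_suffixes.1 hP).1
        omega
      · obtain ⟨rfl, hQ⟩ := (key hb).1 hP
        exact ⟨Q, hQ, rfl⟩
  · rintro ⟨Q, hQ, rfl⟩
    exact (key ha).2 ⟨rfl, hQ⟩

theorem encard_suffixes_of_le (hmn : n ≤ m) (hn : 0 < n) {ρ a : ℕ} (ha : 0 < a)
    (hρ : n ≤ ρ) (β : List ℕ) (c : ℕ) :
    (suffixes m n ρ (a :: β) c).encard =
      (suffixes m n (ρ - n) (a :: β) c).encard +
        (suffixes m n (ρ + a * m - n) β c).encard := by
  have key {b : ℕ} {Q : Path} (hb : 0 < b) :=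
    block_mem_suffixes hmn (ρ := ρ) (b := a) (c := c) (β := β) (P := Q) hb
  simp only [hρ.not_gt, if_false, zero_add] at key
  rw [← (block_injective a).encard_image (suffixes m n (ρ + a * m - n) β c),
    ← (block_injective 0).encard_image (suffixes m n (ρ - n) (a :: β) c),
    ← Set.encard_union_eq]
  · congr 1
    ext P
    constructor
    · intro hP
      rcases eq_nil_or_exists_block (by omega) hP.1 with ⟨rfl, -⟩ | ⟨b, Q, rfl⟩
      · simpa [compType] using hP.2.1
      · rcases Nat.eq_zero_or_pos b with rfl | hb
        · exact Or.inl ⟨Q, (block_zero_mem_suffixes.1 hP).2, rfl⟩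
        · obtain ⟨rfl, hQ⟩ := (key hb).1 hP
          exact Or.inr ⟨Q, hQ, rfl⟩
    · rintro (⟨Q, hQ, rfl⟩ | ⟨Q, hQ, rfl⟩)
      · exact block_zero_mem_suffixes.2 ⟨hρ, hQ⟩
      · exact (key ha).2 ⟨rfl, hQ⟩
  · rw [Set.disjoint_left]
    rintro _ ⟨Q, -, rfl⟩ ⟨Q', -, h⟩
    obtain ⟨a, rfl⟩ : ∃ b, a = b + 1 := ⟨a - 1, by omega⟩
    simp [block, List.replicate_succ] at h

theorem encard_suffixes_cons_succ (hmn : n < m) (hn : 0 < n) {a : ℕ} {β : List ℕ}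
    (hβ : ∀ b ∈ a :: β, 0 < b) (ρ c : ℕ) :
    (suffixes m n ρ (a :: β) (c + 1)).encard =
      (suffixes m n (ρ + a * m - n) β c).encard := by
  induction β generalizing a ρ c with
  | nil =>
    have ha : 0 < a := hβ a (by simp)
    have ham : m ≤ a * m := Nat.le_mul_of_pos_left m ha
    induction ρ using Nat.strong_induction_on with
    | _ ρ ih =>
      rcases lt_or_ge ρ n with hρ | hρ
      · exact encard_suffixes_of_lt hmn.le hn ha hρ _ _
      · rw [encard_suffixes_of_le hmn.le hn ha hρ, ih _ (by omega),
          suffixes_nil_succ, Set.encard_empty, add_zero,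
          encard_suffixes_nil hn (by omega) (ρ := ρ + a * m - n) (by omega)]
        congr 2
        omega
  | cons b β ihβ =>
    have ha : 0 < a := hβ a (by simp)
    have ham : m ≤ a * m := Nat.le_mul_of_pos_left m ha
    induction ρ using Nat.strong_induction_on with
    | _ ρ ih =>
      rcases lt_or_ge ρ n with hρ | hρ
      · exact encard_suffixes_of_lt hmn.le hn ha hρ _ _
      · rw [encard_suffixes_of_le hmn.le hn ha hρ, ih _ (by omega),
          ihβ (fun x hx => hβ x (List.mem_cons_of_mem _ hx)),
          encard_suffixes_of_le hmn.le hn (hβ b (by simp)) (ρ := ρ + a * m - n) (by omega)]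
        congr 3
        omega

theorem runSuffixes_nil_succ (hm : 0 < m) (ρ k c : ℕ) :
    runSuffixes m n ρ [] (k + 1) c = ∅ := by
  rw [Set.eq_empty_iff_forall_notMem]
  rintro P ⟨hP, h, -⟩
  have h0 := h 0 (by omega)
  rcases eq_nil_or_exists_block hm hP.1 with ⟨rfl, -⟩ | ⟨a, Q, rfl⟩
  · simp [coarea_nil] at h0
  · rw [zero_mem_coarea_block] at h0
    have := hP.2.1
    simp [compType_block, h0.ne'] at this

theorem encard_runSuffixes_zero (hm : 0 < m) (hn : 0 < n) {ρ : ℕ} (hρ : n ≤ ρ)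
    (β : List ℕ) (c : ℕ) :
    (runSuffixes m n ρ β 0 c).encard = (suffixes m n (ρ - n) β c).encard := by
  rw [← (block_injective 0).encard_image (suffixes m n (ρ - n) β c)]
  congr 1
  ext P
  constructor
  · rintro ⟨hP, -, h⟩
    rcases eq_nil_or_exists_block hm hP.1 with ⟨-, h⟩ | ⟨a, Q, rfl⟩
    · omega
    · rw [zero_mem_coarea_block, not_lt, Nat.le_zero] at h
      subst h
      exact ⟨Q, (block_zero_mem_suffixes.1 hP).2, rfl⟩
  · rintro ⟨Q, hQ, rfl⟩
    exact ⟨block_zero_mem_suffixes.2 ⟨hρ, hQ⟩, by simp, by simp [zero_mem_coarea_block]⟩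

theorem runSuffixes_cons_succ (hmn : n ≤ m) (hn : 0 < n) {ρ a : ℕ} (ha : 0 < a)
    (β : List ℕ) (k c : ℕ) :
    runSuffixes m n ρ (a :: β) (k + 1) ((if ρ < n then 1 else 0) + c) =
      block a '' runSuffixes m n (ρ + a * m - n) β k c := by
  ext P
  constructor
  · rintro ⟨hP, h, h'⟩
    have h0 := h 0 (by omega)
    rcases eq_nil_or_exists_block (by omega) hP.1 with ⟨rfl, -⟩ | ⟨b, Q, rfl⟩
    · simp [coarea_nil] at h0
    · rw [zero_mem_coarea_block] at h0
      obtain ⟨rfl, hQ⟩ := (block_mem_suffixes hmn h0).1 hP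
      exact ⟨Q, ⟨hQ, fun i hi => succ_mem_coarea_block.1 (h (i + 1) (by omega)),
        fun hk => h' (succ_mem_coarea_block.2 hk)⟩, rfl⟩
  · rintro ⟨Q, ⟨hQ, h, h'⟩, rfl⟩
    refine ⟨(block_mem_suffixes hmn ha).2 ⟨rfl, hQ⟩, ?_,
      fun hk => h' (succ_mem_coarea_block.1 hk)⟩
    rintro (_ | i) hi
    · exact zero_mem_coarea_block.2 ha
    · exact succ_mem_coarea_block.2 (h i (by omega))

theorem encard_runSuffixes_of_le (hmn : n < m) (hn : 0 < n) {ρ : ℕ} {β : List ℕ}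
    (hρ : n ≤ ρ) (hβ : ∀ b ∈ β, 0 < b) (k c : ℕ) :
    (runSuffixes m n ρ β k (c + 1)).encard = (runSuffixes m n ρ β (k + 1) c).encard := by
  have hm : 0 < m := by omega
  induction k generalizing ρ β c with
  | zero =>
    rw [encard_runSuffixes_zero hm hn hρ]
    cases β with
    | nil => rw [suffixes_nil_succ, runSuffixes_nil_succ hm]
    | cons a β =>
      have ha : 0 < a := hβ a (by simp)
      have ham : m ≤ a * m := Nat.le_mul_of_pos_left m ha
      have h := runSuffixes_cons_succ hmn.le hn ha (ρ := ρ) β 0 c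
      simp only [hρ.not_gt, if_false, zero_add] at h
      rw [encard_suffixes_cons_succ hmn hn hβ, zero_add, h, (block_injective a).encard_image,
        encard_runSuffixes_zero hm hn (by omega)]
      congr 2
      omega
  | succ k ih =>
    cases β with
    | nil => rw [runSuffixes_nil_succ hm, runSuffixes_nil_succ hm]
    | cons a β =>
      have ha : 0 < a := hβ a (by simp)
      have ham : m ≤ a * m := Nat.le_mul_of_pos_left m ha
      have h := runSuffixes_cons_succ hmn.le hn ha (ρ := ρ) β
      simp only [hρ.not_gt, if_false, zero_add] at h
      rw [h, h, (block_injective a).encard_image, (block_injective a).encard_image,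
        ih (by omega) fun x hx => hβ x (List.mem_cons_of_mem _ hx)]

/-- The number of initial blocks of composition `β` that are forced to have both minimal
and maximal coarea on every path suffix from rank `ρ`. -/
def forcedBlocks (m n : ℕ) : ℕ → List ℕ → ℕ
  | _, [] => 0
  | ρ, a :: β => if ρ < n then 1 + forcedBlocks m n (ρ + a * m - n) β else 0

theorem encard_runSuffixes_forcedBlocks (hmn : n < m) (hn : 0 < n) {β : List ℕ}
    (hβ : ∀ b ∈ β, 0 < b) (ρ k c : ℕ) :
    (runSuffixes m n ρ β (forcedBlocks m n ρ β + k) (forcedBlocks m n ρ β + (c + 1))).encard =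
      (runSuffixes m n ρ β (forcedBlocks m n ρ β + (k + 1))
        (forcedBlocks m n ρ β + c)).encard := by
  have hm : 0 < m := by omega
  induction β generalizing ρ with
  | nil =>
    simp only [forcedBlocks, zero_add]
    rw [runSuffixes_nil_succ hm, Set.encard_empty, Set.encard_eq_zero,
      Set.eq_empty_iff_forall_notMem]
    intro P hP
    simpa [suffixes_nil_succ] using hP.1
  | cons a β ih =>
    have ha : 0 < a := hβ a (by simp)
    rw [forcedBlocks]
    split_ifs with hρ
    · have h := runSuffixes_cons_succ hmn.le hn ha (ρ := ρ) β
      simp only [hρ, if_true] at h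
      set f := forcedBlocks m n (ρ + a * m - n) β
      rw [show 1 + f + k = f + k + 1 by ring, show 1 + f + (k + 1) = f + (k + 1) + 1 by ring,
        add_assoc 1, add_assoc 1, h, h, (block_injective a).encard_image,
        (block_injective a).encard_image]
      exact ih (fun x hx => hβ x (List.mem_cons_of_mem _ hx)) _
    · simpa using encard_runSuffixes_of_le hmn hn (not_lt.1 hρ) hβ k c

theorem forcedBlocks_eq (hmn : n < m) (hn : 0 < n) {β : List ℕ} (hβ : ∀ b ∈ β, 0 < b)
    {i : ℕ} (hi : i + β.sum = n) :
    forcedBlocks m n (i * (m - n)) β =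
      min (iones β + 1) ((n + (m - n) - 1) / (m - n) - i) := by
  have hd : 0 < m - n := by omega
  have hC : ∀ j, (n + (m - n) - 1) / (m - n) ≤ j ↔ n ≤ j * (m - n) := by
    intro j
    rw [← Nat.lt_succ_iff, Nat.div_lt_iff_lt_mul hd, Nat.succ_mul]
    omega
  induction β generalizing i with
  | nil =>
    have : (n + (m - n) - 1) / (m - n) ≤ i := by
      rw [hC]
      simp only [List.sum_nil, add_zero] at hi
      subst hi
      exact Nat.le_mul_of_pos_right _ hd
    simp [forcedBlocks, Nat.sub_eq_zero_of_le this]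
  | cons a β ih =>
    have ha : 0 < a := hβ a (by simp)
    rw [forcedBlocks]
    split_ifs with h
    · have h' := mt (hC i).1 h.not_ge
      by_cases ha1 : a = 1
      · subst ha1
        have e : i * (m - n) + 1 * m - n = (i + 1) * (m - n) := by
          rw [Nat.succ_mul i, one_mul]
          omega
        simp only [List.sum_cons] at hi
        rw [e, ih (fun x hx => hβ x (List.mem_cons_of_mem _ hx)) (by omega)]
        have : iones (1 :: β) = iones β + 1 := by simp [iones]
        omega
      · have ham : 2 * m ≤ a * m := Nat.mul_le_mul_right m (by omega)
        have : iones (a :: β) = 0 := by simp [iones, ha1]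
        have : forcedBlocks m n (i * (m - n) + a * m - n) β = 0 := by
          cases β with
          | nil => rfl
          | cons b β => rw [forcedBlocks, if_neg (by omega)]
        omega
    · have h' := (hC i).2 (not_lt.1 h)
      omega

theorem le_sum_of_mem_runSuffixes (hmn : n ≤ m) (hn : 0 < n) {ρ k c : ℕ} {β : List ℕ}
    {P : Path} (hP : P ∈ runSuffixes m n ρ β k c) : k ≤ β.sum := by
  induction k generalizing ρ β c P with
  | zero => exact Nat.zero_le _
  | succ k ih =>
    cases β with
    | nil => simp [runSuffixes_nil_succ (show 0 < m by omega)] at hP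
    | cons a β =>
      have ha : 0 < a := pos_of_mem_compType (P := P) (by simp [hP.1.2.1])
      have h0 := hP.2.1 0 (by omega)
      rcases eq_nil_or_exists_block (by omega) hP.1.1 with ⟨rfl, -⟩ | ⟨b, Q, rfl⟩
      · simp [coarea_nil] at h0
      · rw [zero_mem_coarea_block] at h0
        obtain ⟨d, rfl⟩ : ∃ d, c = (if ρ < n then 1 else 0) + d :=
          ⟨_, by rw [← hP.1.2.2, touches_block hmn h0]⟩
        rw [runSuffixes_cons_succ hmn hn ha] at hP
        obtain ⟨Q, hQ, -⟩ := hP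
        have := ih hQ
        simp only [List.sum_cons]
        omega

theorem prefRank_cons_true (P : Path) : prefRank m n (true :: P) = m + prefRank m n P := by
  simp [prefRank]; ring

theorem prefRank_cons_false (P : Path) : prefRank m n (false :: P) = -n + prefRank m n P := by
  simp [prefRank]; ring

theorem isSuffix_iff {ρ : ℕ} {P : Path} :
    IsSuffix m n ρ P ↔
      (∀ i ≤ P.length, 0 ≤ ρ + prefRank m n (P.take i)) ∧ ρ + prefRank m n P = 0 := by
  induction P generalizing ρ with
  | nil => simp [IsSuffix, prefRank]
  | cons s P ih =>
    have split (q : ℕ → Prop) : (∀ i ≤ (s :: P).length, q i) ↔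
        q 0 ∧ ∀ i ≤ P.length, q (i + 1) := by
      constructor
      · exact fun h => ⟨h 0 (by simp), fun i hi => h (i + 1) (by simpa using hi)⟩
      · rintro ⟨h, h'⟩ (_ | i) hi
        · exact h
        · exact h' i (by simpa using hi)
    rw [split]
    have h0 : (0 : ℤ) ≤ ρ + prefRank m n ((s :: P).take 0) := by simp [prefRank]
    simp only [h0, true_and, List.take_succ_cons]
    cases s with
    | true =>
      rw [IsSuffix, ih]
      simp only [prefRank_cons_true, Nat.cast_add, add_assoc]
    | false =>
      rw [IsSuffix, ih]
      simp only [prefRank_cons_false]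
      constructor
      · rintro ⟨h, h'⟩
        simpa only [Nat.cast_sub h, sub_eq_add_neg, add_assoc] using h'
      · intro h'
        have h : n ≤ ρ := by
          have := h'.1 0 (by simp)
          simp [prefRank] at this
          omega
        refine ⟨h, ?_⟩
        simpa only [Nat.cast_sub h, sub_eq_add_neg, add_assoc] using h'

theorem touches_eq {ρ : ℕ} {P : Path} (hP : IsSuffix m n ρ P) :
    touches m n ρ P = ((List.range P.length).filter fun i =>
      ρ + prefRank m n (P.take i) < (n : ℤ)).length := by
  induction P generalizing ρ with
  | nil => simp [touches]
  | cons s P ih =>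
    rw [List.length_cons, List.range_succ_eq_map, List.filter_cons, List.filter_map,
      List.take_zero]
    have h0 : ((ρ : ℤ) + prefRank m n [] < n) ↔ ρ < n := by simp [prefRank]
    cases s with
    | true =>
      rw [touches, ih hP]
      simp only [Function.comp_def, h0, List.take_succ_cons, prefRank_cons_true, Nat.cast_add,
        add_assoc, decide_eq_true_eq]
      split_ifs <;> simp [add_comm]
    | false =>
      rw [touches, ih hP.2]
      simp only [Function.comp_def, h0, List.take_succ_cons, prefRank_cons_false,
        Nat.cast_sub hP.1, add_assoc, decide_eq_true_eq, sub_eq_add_neg]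
      split_ifs <;> simp [add_comm]

theorem coe_dyckPathsCompRR (hmn : n < m) (hn : 0 < n) {α : List ℕ} (hα : α.sum = n)
    {k : ℕ} (hk : 0 < k) (c : ℕ) :
    (dyckPathsCompRR m n α k c : Set Path) = runSuffixes m n 0 α k c := by
  have hdyck (P : Path) (hP : compType P = α) : P ∈ dyckPaths m n ↔ IsSuffix m n 0 P := by
    have ht : P.count true = n := by rw [← sum_compType, hP, hα]
    have hlen : P.count true + P.count false = P.length := by simp
    have hrank : (0 : ℤ) + prefRank m n P = 0 ↔ P.count false = m := by
      rw [zero_add, prefRank, ht, sub_eq_zero, mul_comm (n : ℤ),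
        mul_left_inj' (by exact_mod_cast hn.ne')]
      exact_mod_cast eq_comm
    rw [isSuffix_iff, Nat.cast_zero, hrank]
    simp only [zero_add]
    rw [dyckPaths, Finset.mem_filter, IsDyck]
    simp only [Finset.mem_image, Finset.mem_univ, true_and]
    constructor
    · rintro ⟨-, h, -, h'⟩
      exact ⟨h', h⟩
    · rintro ⟨h', h⟩
      refine ⟨?_, h, ht, h'⟩
      have hl : P.length = m + n := by omega
      exact ⟨fun i => P.get (i.cast hl.symm), by
        apply List.ext_get <;> simp [hl]⟩
  ext P
  simp only [dyckPathsCompRR, dyckPathsComp, Finset.coe_filter, Finset.mem_filter,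
    Set.mem_ofPred_eq, runSuffixes, suffixes]
  constructor
  · rintro ⟨⟨hP, hc⟩, hrun, hret⟩
    rw [hdyck P hc] at hP
    have ht : P.count true = n := by rw [← sum_compType, hc, hα]
    have hmem := Nat.sInf_mem (Nat.nonempty_of_pos_sInf (hrun ▸ hk))
    rw [show sInf _ = k from hrun] at hmem
    refine ⟨⟨hP, hc, ?_⟩, ?_, hmem.2.2⟩
    · rw [touches_eq hP, ← hret]
      simp [retStat]
    · rintro (_ | i) hi
      · rcases eq_nil_or_exists_block (by omega) hP with ⟨rfl, -⟩ | ⟨b, Q, rfl⟩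
        · simp at ht
          omega
        · rw [zero_mem_coarea_block]
          rw [isSuffix_block] at hP
          by_contra hb
          simp [Nat.eq_zero_of_not_pos hb] at hP
          omega
      · by_contra h
        have := Nat.sInf_le (show i + 1 ∈ {i : ℕ | 1 ≤ i ∧ i ≤ P.count true ∧ i ∉ coarea P} from
          ⟨by omega, by have := hmem.2.1; omega, h⟩)
        rw [show sInf _ = k from hrun] at this
        omega
  · intro h
    have hkn := le_sum_of_mem_runSuffixes hmn.le hn h
    obtain ⟨⟨hP, hc, ht⟩, hlt, hkk⟩ := h
    refine ⟨⟨(hdyck P hc).2 hP, hc⟩, ?_, ?_⟩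
    · refine IsLeast.csInf_eq ⟨⟨hk, ?_, hkk⟩, ?_⟩
      · rwa [← sum_compType, hc]
      · rintro j ⟨-, -, hj⟩
        exact not_lt.1 fun hjk => hj (hlt j hjk)
    · rw [← ht, touches_eq hP]
      simp [retStat]

end Suffix

/-- For `m > n`, a composition `α ⊨ n` and `r = rr(α,m)`, the sets
`D_{m,α}^{(r+a, r+b-a)}` and `D_{m,α}^{(r+b, r)}` are equinumerous for all `0 ≤ a ≤ b`. -/
theorem card_comp_run_ret (m n : ℕ) (hn : 0 < n) (hmn : n < m)
    (α : List ℕ) (hα : IsComposition n α) (a b : ℕ) (hab : a ≤ b) :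
    (dyckPathsCompRR m n α (rr m α + a) (rr m α + b - a)).card =
      (dyckPathsCompRR m n α (rr m α + b) (rr m α)).card := by
  obtain ⟨hpos, hsum⟩ := hα
  have hr : rr m α = forcedBlocks m n 0 α := by
    have h := forcedBlocks_eq hmn hn hpos (i := 0) (by simpa using hsum)
    rw [zero_mul, Nat.sub_zero] at h
    rw [h, rr, hsum]
  have hr0 : 0 < rr m α := by
    cases α with
    | nil => simp at hsum; omega
    | cons x α => rw [hr, forcedBlocks, if_pos hn]; omega
  obtain ⟨d, rfl⟩ := Nat.exists_eq_add_of_le hab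
  clear hab
  rw [show rr m α + (a + d) - a = rr m α + d by omega]
  induction d generalizing a with
  | zero => rfl
  | succ d ih =>
    rw [show a + (d + 1) = a + 1 + d by ring, ← ih (a + 1)]
    have h := encard_runSuffixes_forcedBlocks hmn hn hpos 0 a d
    rw [← hr, ← coe_dyckPathsCompRR hmn hn hsum (by omega),
      ← coe_dyckPathsCompRR hmn hn hsum (by omega), Set.encard_coe_eq_coe_finsetCard,
      Set.encard_coe_eq_coe_finsetCard] at h
    exact_mod_cast h

end RationalDyck
end

section
/- Let m > n be positive integers and let α be a composition of n. Then ∑_{P ∈ D_{m,α}} p^{run(P)} q^{ret(P)} = ∑_{P ∈ D_{m,α}} p^{ret(P)} q^{run(P)} as polynomials in the indeterminates p and q. -/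
open scoped Classical

namespace RationalDyck

/-- The change of rank along a single step. -/
def stepRank (m n : ℕ) (s : Bool) : ℤ := if s then (m : ℤ) else -(n : ℤ)

/-- `Q`, started at a point of rank `r`, only visits points of nonnegative rank. -/
def NonnegFrom (m n : ℕ) : ℤ → Path → Prop
  | r, [] => 0 ≤ r
  | r, s :: Q => 0 ≤ r ∧ NonnegFrom m n (r + stepRank m n s) Q

/-- The number of points of rank less than `n`, other than the endpoint, visited by `Q` when it is
started at a point of rank `r`. -/
def retFrom (m n : ℕ) : ℤ → Path → ℕ
  | _, [] => 0
  | r, s :: Q => (if r < n then 1 else 0) + retFrom m n (r + stepRank m n s) Q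

lemma prefRank_cons (m n : ℕ) (s : Bool) (Q : Path) :
    prefRank m n (s :: Q) = stepRank m n s + prefRank m n Q := by
  cases s <;> simp [prefRank, stepRank] <;> ring

lemma nonnegFrom_iff (m n : ℕ) (r : ℤ) (Q : Path) :
    NonnegFrom m n r Q ↔ ∀ i ≤ Q.length, 0 ≤ r + prefRank m n (Q.take i) := by
  induction Q generalizing r with
  | nil => simp [NonnegFrom, prefRank]
  | cons s Q ih =>
    rw [NonnegFrom, ih]
    constructor
    · rintro ⟨h0, h⟩ (_ | i) hi
      · simpa [prefRank] using h0
      · have := h i (by simpa using hi)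
        rw [List.take_succ_cons, prefRank_cons]
        linarith
    · intro h
      refine ⟨by simpa [prefRank] using h 0 (by simp), fun i hi => ?_⟩
      have := h (i + 1) (by simpa using hi)
      rw [List.take_succ_cons, prefRank_cons] at this
      linarith

lemma length_filter_rank_eq_retFrom (m n : ℕ) (r : ℤ) (Q : Path) :
    ((List.range Q.length).filter fun i => r + prefRank m n (Q.take i) < (n : ℤ)).length
      = retFrom m n r Q := by
  induction Q generalizing r with
  | nil => simp [retFrom]
  | cons s Q ih =>
    rw [retFrom, ← ih, List.length_cons, List.range_succ_eq_map, List.filter_cons, List.filter_map,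
      List.take_zero]
    have h : ∀ i : ℕ, r + prefRank m n ((s :: Q).take (i + 1))
        = r + stepRank m n s + prefRank m n (Q.take i) := fun i => by
      rw [List.take_succ_cons, prefRank_cons, add_assoc]
    simp only [Function.comp_def, Nat.succ_eq_add_one, h]
    by_cases hr : r < n <;> simp [hr, prefRank, add_comm]

lemma retStat_eq_retFrom (m n : ℕ) (P : Path) : retStat m n P = retFrom m n 0 P := by
  simp [← length_filter_rank_eq_retFrom, retStat]

lemma NonnegFrom.nonneg {m n : ℕ} {r : ℤ} {Q : Path} (h : NonnegFrom m n r Q) : 0 ≤ r := by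
  cases Q with
  | nil => exact h
  | cons s Q => exact h.1

lemma nonnegFrom_replicate_false_append (m n k : ℕ) (r : ℤ) (Q : Path) :
    NonnegFrom m n r (List.replicate k false ++ Q) ↔ NonnegFrom m n (r - k * n) Q := by
  induction k generalizing r with
  | zero => simp
  | succ k ih =>
    rw [List.replicate_succ, List.cons_append, NonnegFrom, ih]
    have e : r + stepRank m n false - k * n = r - (k + 1 : ℕ) * n := by
      simp [stepRank]; ring
    rw [e]
    refine ⟨fun h => h.2, fun h => ⟨?_, h⟩⟩
    have := h.nonneg
    have : (0 : ℤ) ≤ (k + 1 : ℕ) * n := by positivity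
    linarith

lemma nonnegFrom_replicate_true_append (m n k : ℕ) (r : ℤ) (Q : Path) (hr : 0 ≤ r) :
    NonnegFrom m n r (List.replicate k true ++ Q) ↔ NonnegFrom m n (r + k * m) Q := by
  induction k generalizing r with
  | zero => simp
  | succ k ih =>
    have e : r + stepRank m n true + k * m = r + (k + 1 : ℕ) * m := by
      simp [stepRank]; ring
    rw [List.replicate_succ, List.cons_append, NonnegFrom, ih, e]
    · simp [hr]
    · simp [stepRank]; positivity

lemma retFrom_replicate_false_append (m n k : ℕ) (r : ℤ) (Q : Path) (hr : 0 ≤ r - k * n) :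
    retFrom m n r (List.replicate k false ++ Q) = retFrom m n (r - k * n) Q := by
  induction k generalizing r with
  | zero => simp
  | succ k ih =>
    have e : r + stepRank m n false - k * n = r - (k + 1 : ℕ) * n := by
      simp [stepRank]; ring
    have h : ¬ r < n := by
      have : (0 : ℤ) ≤ k * n := by positivity
      push_cast at hr
      linarith
    rw [List.replicate_succ, List.cons_append, retFrom, ih _ (by rw [e]; exact hr), e, if_neg h,
      zero_add]

lemma retFrom_replicate_true_append {m n : ℕ} (hmn : n < m) (k : ℕ) (r : ℤ) (Q : Path)
    (hr : n ≤ r) :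
    retFrom m n r (List.replicate k true ++ Q) = retFrom m n (r + k * m) Q := by
  induction k generalizing r with
  | zero => simp
  | succ k ih =>
    have e : r + stepRank m n true + k * m = r + (k + 1 : ℕ) * m := by
      simp [stepRank]; ring
    rw [List.replicate_succ, List.cons_append, retFrom, ih, e, if_neg (by omega), zero_add]
    simp [stepRank]; omega

lemma coarea_cons (s : Bool) (Q : Path) :
    coarea (s :: Q) = if s then 0 :: coarea Q else (coarea Q).map (· + 1) := by
  unfold coarea
  rw [List.length_cons, List.range_succ_eq_map, List.filterMap_cons, List.filterMap_map]
  cases s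
  · simp only [List.map_filterMap]
    simp [apply_ite]
  · simp

lemma length_coarea (Q : Path) : (coarea Q).length = Q.count true := by
  induction Q with
  | nil => simp [coarea]
  | cons s Q ih => cases s <;> simp [coarea_cons, ih]

/-- The least column which contains no north step of `Q`. -/
noncomputable def firstGap (Q : Path) : ℕ := sInf {r : ℕ | r ∉ coarea Q}

lemma firstGap_notMem_coarea (Q : Path) : firstGap Q ∉ coarea Q :=
  Nat.sInf_mem (s := {r : ℕ | r ∉ coarea Q})
    ⟨(coarea Q).sum + 1, fun h => by
      have := List.single_le_sum (fun _ _ => Nat.zero_le _) _ h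
      omega⟩

lemma firstGap_eq_iff {Q : Path} {k : ℕ} :
    firstGap Q = k ↔ k ∉ coarea Q ∧ ∀ r < k, r ∈ coarea Q := by
  constructor
  · rintro rfl
    exact ⟨firstGap_notMem_coarea Q, fun r hr => not_not.1 (Nat.notMem_of_lt_sInf hr)⟩
  · rintro ⟨h1, h2⟩
    refine le_antisymm (Nat.sInf_le h1) (not_lt.1 fun h => ?_)
    exact firstGap_notMem_coarea Q (h2 _ h)

lemma firstGap_le_count (Q : Path) : firstGap Q ≤ Q.count true := by
  rw [← length_coarea, ← Finset.card_range (firstGap Q)]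
  refine (Finset.card_le_card (t := (coarea Q).toFinset) fun r hr => ?_).trans
    (List.toFinset_card_le _)
  exact List.mem_toFinset.2 ((firstGap_eq_iff.1 rfl).2 r (Finset.mem_range.1 hr))

lemma runStat_eq_firstGap {P : Path} (h : 0 ∈ coarea P) : runStat P = firstGap P := by
  have h1 := firstGap_notMem_coarea P
  have hpos : 1 ≤ firstGap P := by
    rw [Nat.one_le_iff_ne_zero]
    rintro h0
    exact h1 (h0 ▸ h)
  refine le_antisymm (Nat.sInf_le ⟨hpos, firstGap_le_count P, h1⟩) ?_
  exact le_csInf ⟨_, hpos, firstGap_le_count P, h1⟩ fun i hi => Nat.sInf_le hi.2.2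

lemma firstGap_cons_false (Q : Path) : firstGap (false :: Q) = 0 := by
  simp [firstGap_eq_iff, coarea_cons]

lemma firstGap_replicate_true_append {a : ℕ} (ha : 0 < a) (Q : Path) :
    firstGap (List.replicate a true ++ false :: Q) = firstGap Q + 1 := by
  have key : ∀ r, r ∈ coarea (List.replicate a true ++ false :: Q) ↔
      r = 0 ∨ ∃ s ∈ coarea Q, s + 1 = r := by
    induction a, ha using Nat.le_induction with
    | base => simp [coarea_cons]
    | succ a _ ih =>
      intro r
      rw [List.replicate_succ, List.cons_append, coarea_cons, if_pos rfl, List.mem_cons, ih r]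
      tauto
  rw [firstGap_eq_iff, key]
  refine ⟨by simpa using firstGap_notMem_coarea Q, fun r hr => (key r).2 ?_⟩
  rcases r with _ | r
  · simp
  · exact Or.inr ⟨r, (firstGap_eq_iff.1 rfl).2 r (by omega), rfl⟩

lemma compType_cons_false (Q : Path) : compType (false :: Q) = compType Q := by
  simp [compType, List.splitOn_cons_eq_if_modifyHead]

lemma compType_replicate_false_append (k : ℕ) (Q : Path) :
    compType (List.replicate k false ++ Q) = compType Q := by
  induction k with
  | zero => simp
  | succ k ih => rw [List.replicate_succ, List.cons_append, compType_cons_false, ih]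

lemma compType_replicate_true_append {a : ℕ} (ha : 0 < a) (Q : Path) :
    compType (List.replicate a true ++ false :: Q) = a :: compType Q := by
  have h : List.splitOn false (List.replicate a true ++ false :: Q)
      = List.replicate a true :: List.splitOn false Q :=
    List.splitOn_append_cons_self_of_not_mem (by simp) _
  simp [compType, h, ha.ne']

/-- Every path is a run of east steps, possibly followed by a block of north steps, possibly
followed by an east step and a further path. -/
lemma path_cases (Q : Path) :
    (∃ k, Q = List.replicate k false) ∨
    (∃ k a, 0 < a ∧ Q = List.replicate k false ++ List.replicate a true) ∨
    ∃ k a Q', 0 < a ∧ Q = List.replicate k false ++ (List.replicate a true ++ false :: Q') := by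
  induction Q with
  | nil => exact Or.inl ⟨0, rfl⟩
  | cons s Q ih =>
    cases s
    · rcases ih with ⟨k, rfl⟩ | ⟨k, a, ha, rfl⟩ | ⟨k, a, Q', ha, rfl⟩
      · exact Or.inl ⟨k + 1, rfl⟩
      · exact Or.inr (Or.inl ⟨k + 1, a, ha, rfl⟩)
      · exact Or.inr (Or.inr ⟨k + 1, a, Q', ha, rfl⟩)
    · rcases ih with ⟨_ | k, rfl⟩ | ⟨_ | k, a, ha, rfl⟩ | ⟨_ | k, a, Q', ha, rfl⟩
      · exact Or.inr (Or.inl ⟨0, 1, one_pos, rfl⟩)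
      · exact Or.inr (Or.inr ⟨0, 1, _, one_pos, rfl⟩)
      · exact Or.inr (Or.inl ⟨0, a + 1, by omega, rfl⟩)
      · exact Or.inr (Or.inr ⟨0, 1, _, one_pos, rfl⟩)
      · exact Or.inr (Or.inr ⟨0, a + 1, Q', by omega, rfl⟩)
      · exact Or.inr (Or.inr ⟨0, 1, _, one_pos, rfl⟩)

/-- The path which makes `k` east steps, a block of `a` north steps and one more east step, and
then continues with `Q`. -/
def blockCons (k a : ℕ) (Q : Path) : Path :=
  List.replicate k false ++ (List.replicate a true ++ false :: Q)

lemma blockCons_inj {a : ℕ} (ha : 0 < a) {k k' : ℕ} {Q Q' : Path} :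
    blockCons k a Q = blockCons k' a Q' ↔ k = k' ∧ Q = Q' := by
  refine ⟨fun h => ?_, by rintro ⟨rfl, rfl⟩; rfl⟩
  obtain ⟨a, rfl⟩ := Nat.exists_eq_succ_of_ne_zero ha.ne'
  unfold blockCons at h
  induction k generalizing k' with
  | zero => cases k' <;> simp_all [List.replicate_succ]
  | succ k ih =>
    cases k' with
    | zero => simp [List.replicate_succ] at h
    | succ k' => simpa using @ih k' (by simpa [List.replicate_succ] using h)

/-- The ways of completing a path that has reached `(i, A)` to an `m × n` Dyck path, the remaining
blocks of north steps having lengths `α`. -/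
noncomputable def completions (m n : ℕ) : List ℕ → ℕ → ℕ → Finset Path
  | [], i, _ => {List.replicate (m - i) false}
  | a :: α, i, A => (Finset.Icc i (m * A / n)).biUnion fun c =>
      (completions m n α (c + 1) (A + a)).image (blockCons (c - i) a)

lemma sum_completions_cons {R : Type*} [AddCommMonoid R] {m n a : ℕ} (ha : 0 < a) (α : List ℕ)
    (i A : ℕ) (f : Path → R) :
    ∑ Q ∈ completions m n (a :: α) i A, f Q =
      ∑ c ∈ Finset.Icc i (m * A / n), ∑ Q ∈ completions m n α (c + 1) (A + a),
        f (blockCons (c - i) a Q) := by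
  rw [completions, Finset.sum_biUnion]
  · refine Finset.sum_congr rfl fun c _ => Finset.sum_image fun Q _ Q' _ h => ?_
    exact ((blockCons_inj ha).1 h).2
  · intro c hc c' hc' hne
    simp only [Finset.coe_Icc, Set.mem_Icc] at hc hc'
    refine Finset.disjoint_left.2 fun Q hQ hQ' => hne ?_
    obtain ⟨S, _, rfl⟩ := Finset.mem_image.1 hQ
    obtain ⟨S', _, h⟩ := Finset.mem_image.1 hQ'
    have := ((blockCons_inj ha).1 h).1
    omega

lemma compType_blockCons {a : ℕ} (ha : 0 < a) (k : ℕ) (Q : Path) :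
    compType (blockCons k a Q) = a :: compType Q := by
  rw [blockCons, compType_replicate_false_append, compType_replicate_true_append ha]

lemma nonnegFrom_blockCons {m n k a : ℕ} {r : ℤ} {Q : Path} :
    NonnegFrom m n r (blockCons k a Q) ↔
      0 ≤ r - k * n ∧ NonnegFrom m n (r - k * n + a * m - n) Q := by
  rw [blockCons, nonnegFrom_replicate_false_append]
  constructor
  · intro h
    have h0 : 0 ≤ r - k * n := h.nonneg
    rw [nonnegFrom_replicate_true_append _ _ _ _ _ h0, NonnegFrom] at h
    exact ⟨h0, by simpa [stepRank, sub_eq_add_neg] using h.2⟩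
  · rintro ⟨h0, h⟩
    rw [nonnegFrom_replicate_true_append _ _ _ _ _ h0, NonnegFrom]
    exact ⟨by positivity, by simpa [stepRank, sub_eq_add_neg] using h⟩

lemma retFrom_blockCons {m n k a : ℕ} (hmn : n < m) (ha : 0 < a) {r : ℤ} (Q : Path)
    (hr : 0 ≤ r - k * n) :
    retFrom m n r (blockCons k a Q) =
      (if r - k * n < n then 1 else 0) + retFrom m n (r - k * n + a * m - n) Q := by
  obtain ⟨a, rfl⟩ := Nat.exists_eq_succ_of_ne_zero ha.ne'
  rw [blockCons, retFrom_replicate_false_append _ _ _ _ _ hr, Nat.succ_eq_add_one,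
    List.replicate_succ, List.cons_append, retFrom]
  have h : (n : ℤ) ≤ r - k * n + stepRank m n true := by
    simp only [stepRank, if_true]; omega
  have h' : (0 : ℤ) ≤ a * m := by positivity
  rw [retFrom_replicate_true_append hmn _ _ _ h, retFrom,
    if_neg (not_lt.2 (h.trans (le_add_of_nonneg_right h'))), zero_add]
  congr 2
  simp only [stepRank, if_true, Bool.false_eq_true, if_false]
  push_cast
  ring

/-- For a path that has reached `(i, A)`, the next block of north steps may start in column `c`
exactly if `c ≤ m * A / n`. -/
lemma rank_nonneg_iff {m n A c : ℕ} (hn : 0 < n) :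
    0 ≤ (A * m - c * n : ℤ) ↔ c ≤ m * A / n := by
  rw [Nat.le_div_iff_mul_le hn, sub_nonneg, mul_comm m]
  exact_mod_cast Iff.rfl

lemma rank_lt_iff {m n A c : ℕ} (hn : 0 < n) (hc : c ≤ m * A / n) :
    (A * m - c * n : ℤ) < n ↔ c = m * A / n := by
  have h : (A * m - c * n : ℤ) < n ↔ ¬ c + 1 ≤ m * A / n := by
    rw [← rank_nonneg_iff hn]
    push_cast
    constructor <;> intro h <;> linarith
  omega

lemma column_lt {m n A c : ℕ} (hm : 0 < m) (hA : A < n) (hc : c ≤ m * A / n) : c < m :=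
  hc.trans_lt ((Nat.div_lt_iff_lt_mul (by omega)).2 (Nat.mul_lt_mul_of_pos_left hA hm))

lemma rank_blockCons {m n i A a c : ℕ} (hc : i ≤ c) :
    (A * m - i * n : ℤ) - (c - i : ℕ) * n + a * m - n = (A + a : ℕ) * m - (c + 1 : ℕ) * n := by
  push_cast [hc]
  ring

lemma mem_completions {m n : ℕ} (hn : 0 < n) (hmn : n < m) {α : List ℕ} (hα : ∀ a ∈ α, 0 < a)
    {i A : ℕ} (hA : A + α.sum = n) (hi : i ≤ m) {Q : Path} :
    Q ∈ completions m n α i A ↔ Q.count false + i = m ∧ Q.count true + A = n ∧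
      NonnegFrom m n (A * m - i * n) Q ∧ compType Q = α := by
  induction α generalizing i A Q with
  | nil =>
    obtain rfl : A = n := by simpa using hA
    rw [completions, Finset.mem_singleton]
    constructor
    · rintro rfl
      refine ⟨by simp [hi], by simp [List.count_replicate], ?_, ?_⟩
      · rw [← List.append_nil (List.replicate _ _), nonnegFrom_replicate_false_append, NonnegFrom]
        push_cast [hi]
        apply le_of_eq; ring
      · rw [← List.append_nil (List.replicate _ _), compType_replicate_false_append]
        simp [compType]
    · rintro ⟨h1, h2, -, -⟩
      have h : ∀ b ∈ Q, b = false := fun b hb => by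
        cases b
        · rfl
        · have := List.count_pos_iff.2 hb
          omega
      have hQ := List.eq_replicate_of_mem h
      have hl : Q.length = m - i := by
        rw [hQ, List.count_replicate_self] at h1
        omega
      rw [hQ, hl]
  | cons a α ih =>
    have ha : 0 < a := hα a (by simp)
    have hα' : ∀ b ∈ α, 0 < b := fun b hb => hα b (by simp [hb])
    rw [List.sum_cons] at hA
    simp only [completions, Finset.mem_biUnion, Finset.mem_Icc, Finset.mem_image]
    constructor
    · rintro ⟨c, ⟨hic, hc⟩, Q', hQ', rfl⟩
      have hcm : c < m := column_lt (by omega) (by omega) hc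
      rw [ih hα' (by omega) (by omega)] at hQ'
      obtain ⟨h1, h2, h3, h4⟩ := hQ'
      refine ⟨?_, ?_, ?_, ?_⟩
      · simp [blockCons, List.count_replicate]; omega
      · simp [blockCons, List.count_replicate]; omega
      · rw [nonnegFrom_blockCons, rank_blockCons hic]
        refine ⟨?_, h3⟩
        have := (rank_nonneg_iff hn).2 hc
        push_cast [hic]
        linarith
      · rw [compType_blockCons ha, h4]
    · rintro ⟨h1, h2, h3, h4⟩
      rcases path_cases Q with ⟨k, rfl⟩ | ⟨k, b, hb, rfl⟩ | ⟨k, b, Q', hb, rfl⟩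
      · simp [List.count_replicate] at h2; omega
      · have h5 := ((nonnegFrom_replicate_false_append ..).1 h3).nonneg
        simp [List.count_replicate] at h1 h2
        have h6 : 0 ≤ (A * m - (i + k : ℕ) * n : ℤ) := by push_cast; linarith
        have := column_lt (by omega) (by omega) ((rank_nonneg_iff hn).1 h6)
        omega
      · change NonnegFrom m n _ (blockCons k b Q') at h3
        change compType (blockCons k b Q') = _ at h4
        rw [compType_blockCons hb, List.cons.injEq] at h4
        obtain ⟨rfl, h4⟩ := h4
        rw [nonnegFrom_blockCons] at h3
        have h6 : 0 ≤ (A * m - (i + k : ℕ) * n : ℤ) := by push_cast; linarith [h3.1]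
        have hc := (rank_nonneg_iff hn).1 h6
        have := column_lt (by omega) (by omega) hc
        refine ⟨i + k, ⟨by omega, hc⟩, Q', ?_, by rw [Nat.add_sub_cancel_left]; rfl⟩
        rw [ih hα' (by omega) (by omega)]
        simp [List.count_replicate] at h1 h2
        refine ⟨by omega, by omega, ?_, h4⟩
        rw [← rank_blockCons (Nat.le_add_right i k), Nat.add_sub_cancel_left]
        exact h3.2

lemma dyckPathsComp_eq_completions {m n : ℕ} (hn : 0 < n) (hmn : n < m) {α : List ℕ}
    (hα : IsComposition n α) : dyckPathsComp m n α = completions m n α 0 0 := by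
  ext P
  rw [mem_completions hn hmn hα.1 (by simpa using hα.2) (Nat.zero_le _), nonnegFrom_iff,
    dyckPathsComp, Finset.mem_filter, dyckPaths, Finset.mem_filter]
  simp only [IsDyck, Nat.cast_zero, zero_mul, sub_zero, zero_add, add_zero]
  constructor
  · rintro ⟨⟨-, h1, h2, h3⟩, h4⟩
    exact ⟨h1, h2, h3, h4⟩
  · rintro ⟨h1, h2, h3, h4⟩
    refine ⟨⟨?_, h1, h2, h3⟩, h4⟩
    have hl : P.length = m + n := by
      rw [← h1, ← h2, List.count_false_add_count_true]
    exact Finset.mem_image.2 ⟨fun i => P.get (i.cast hl.symm), Finset.mem_univ _,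
      (List.ofFn_congr hl P.get).symm.trans (List.ofFn_get P)⟩

/-- The generating function of the weakly increasing sequences `d` with `x ≤ d` and `d ≤ b`
termwise, where `p` marks the terms equal to `0` and `q` the terms equal to their bound. -/
def seqWeight {R : Type*} [CommRing R] (p q : R) : List ℕ → ℕ → R
  | [], _ => 1
  | b :: bs, x => ∑ d ∈ Finset.Icc x b,
      (if d = 0 then p else 1) * (if d = b then q else 1) * seqWeight p q bs d

section SeqWeight

variable {R : Type*} [CommRing R]

lemma seqWeight_cons_split (p q : R) {x y b : ℕ} (bs : List ℕ) (hxy : x ≤ y) (hyb : y ≤ b) :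
    seqWeight p q (b :: bs) x =
      ∑ d ∈ Finset.Ico x y, (if d = 0 then p else 1) * seqWeight p q bs d +
        seqWeight p q (b :: bs) y := by
  have hIcc : ∀ z, Finset.Icc z b = Finset.Ico z (b + 1) := fun z => by
    ext; simp
  rw [seqWeight, seqWeight, hIcc, hIcc, ← Finset.sum_Ico_consecutive _ hxy (by omega)]
  refine congrArg₂ _ (Finset.sum_congr rfl fun d hd => ?_) rfl
  rw [Finset.mem_Ico] at hd
  rw [if_neg (show d ≠ b by omega), mul_one]

lemma seqWeight_cons_self (p q : R) {b : ℕ} (bs : List ℕ) (hb : 0 < b) :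
    seqWeight p q (b :: bs) b = q * seqWeight p q bs b := by
  simp [seqWeight, hb.ne']

lemma seqWeight_cons_of_lt (p q : R) {x b : ℕ} {bs : List ℕ} (hbs : (b :: bs).IsChain (· ≤ ·))
    (hx : x < b) :
    seqWeight p q (b :: bs) x = seqWeight p 0 (b :: bs) x + q * seqWeight p q bs x := by
  induction bs generalizing b x with
  | nil =>
    rw [seqWeight_cons_split p q [] hx.le le_rfl, seqWeight_cons_split p 0 [] hx.le le_rfl,
      seqWeight_cons_self _ _ _ (by omega), seqWeight_cons_self _ _ _ (by omega)]
    simp [seqWeight]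
  | cons c bs ih =>
    rw [List.isChain_cons_cons] at hbs
    have h : ∑ d ∈ Finset.Ico x b, (if d = 0 then p else 1) * seqWeight p q (c :: bs) d =
        ∑ d ∈ Finset.Ico x b, (if d = 0 then p else 1) * seqWeight p 0 (c :: bs) d +
          q * ∑ d ∈ Finset.Ico x b, (if d = 0 then p else 1) * seqWeight p q bs d := by
      rw [Finset.mul_sum, ← Finset.sum_add_distrib]
      refine Finset.sum_congr rfl fun d hd => ?_
      rw [Finset.mem_Ico] at hd
      rw [ih hbs.2 (by omega)]
      ring
    rw [seqWeight_cons_split p q _ hx.le le_rfl, seqWeight_cons_split p 0 _ hx.le le_rfl,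
      seqWeight_cons_self _ _ _ (by omega), seqWeight_cons_self _ _ _ (by omega), h,
      seqWeight_cons_split p q bs hx.le hbs.1]
    ring

lemma seqWeight_congr_left (p p' q : R) (bs : List ℕ) {x : ℕ} (hx : 0 < x) :
    seqWeight p q bs x = seqWeight p' q bs x := by
  induction bs generalizing x with
  | nil => rfl
  | cons b bs ih =>
    refine Finset.sum_congr rfl fun d hd => ?_
    rw [Finset.mem_Icc] at hd
    have hd0 : d ≠ 0 := by omega
    rw [if_neg hd0, if_neg hd0, ih (by omega)]

lemma seqWeight_cons_zero (p q : R) {b : ℕ} (bs : List ℕ) (hb : 0 < b) :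
    seqWeight p q (b :: bs) 0 = seqWeight 0 q (b :: bs) 0 + p * seqWeight p q bs 0 := by
  rw [seqWeight_cons_split p q bs zero_le_one hb, seqWeight_cons_split 0 q bs zero_le_one hb,
    seqWeight_congr_left p 0 q (b :: bs) one_pos]
  simp [add_comm]

lemma seqWeight_comm (p q : R) {bs : List ℕ} (hbs : bs.IsChain (· ≤ ·)) :
    seqWeight p q bs 0 = seqWeight q p bs 0 := by
  induction bs generalizing p q with
  | nil => rfl
  | cons b bs ih =>
    have hbs' : bs.IsChain (· ≤ ·) := hbs.tail
    rcases Nat.eq_zero_or_pos b with rfl | hb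
    · simp [seqWeight, ih p q hbs', mul_comm p q]
    · rw [seqWeight_cons_of_lt p q hbs hb, seqWeight_cons_zero p 0 bs hb,
        seqWeight_cons_zero q p bs hb, seqWeight_cons_of_lt 0 p hbs hb, ih p 0 hbs', ih p q hbs']

end SeqWeight

/-- For a path that has reached height `A` after `j` blocks of north steps, the largest starting
columns of the remaining blocks, of lengths `α`, minus the numbers of preceding blocks. -/
def columnBounds (m n : ℕ) : List ℕ → ℕ → ℕ → List ℕ
  | [], _, _ => []
  | a :: α, A, j => (m * A / n - j) :: columnBounds m n α (A + a) (j + 1)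

lemma isChain_columnBounds {m n : ℕ} (hn : 0 < n) (hmn : n < m) {α : List ℕ}
    (hα : ∀ a ∈ α, 0 < a) (A j : ℕ) : (columnBounds m n α A j).IsChain (· ≤ ·) := by
  induction α generalizing A j with
  | nil => exact List.isChain_nil
  | cons a α ih =>
    have hα' : ∀ b ∈ α, 0 < b := fun b hb => hα b (by simp [hb])
    have h := ih hα' (A + a) (j + 1)
    cases α with
    | nil => exact List.isChain_singleton _
    | cons b α =>
      refine List.isChain_cons_cons.2 ⟨?_, h⟩
      have ha := hα a (by simp)
      have : m * A / n + 1 ≤ m * (A + a) / n := by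
        rw [← Nat.add_div_right _ hn]
        apply Nat.div_le_div_right
        nlinarith
      omega

lemma sum_completions_eq_seqWeight {R : Type*} [CommRing R] (p q : R) {m n : ℕ} (hn : 0 < n)
    (hmn : n < m) {α : List ℕ} (hα : ∀ a ∈ α, 0 < a) {i j A : ℕ} (hA : A + α.sum = n) (hi : i ≤ m)
    (hji : j ≤ i) (hjA : j ≤ A) :
    ∑ Q ∈ completions m n α i A,
        (if i = j then p ^ firstGap Q else 1) * q ^ retFrom m n (A * m - i * n) Q =
      seqWeight p q (columnBounds m n α A j) (i - j) := by
  induction α generalizing i j A with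
  | nil =>
    obtain rfl : A = n := by simpa using hA
    have h1 : firstGap (List.replicate (m - i) false) = 0 := by
      cases m - i with
      | zero => simp [firstGap_eq_iff, coarea]
      | succ k => exact firstGap_cons_false _
    have h2 : retFrom m A (A * m - i * A) (List.replicate (m - i) false) = 0 := by
      rw [← List.append_nil (List.replicate _ _), retFrom_replicate_false_append, retFrom]
      push_cast [hi]
      apply le_of_eq; ring
    simp [completions, columnBounds, seqWeight, h1, h2]
  | cons a α ih =>
    have ha : 0 < a := hα a (by simp)
    have hα' : ∀ b ∈ α, 0 < b := fun b hb => hα b (by simp [hb])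
    rw [List.sum_cons] at hA
    have hAB : A ≤ m * A / n := by
      rw [Nat.le_div_iff_mul_le hn]
      nlinarith
    rw [sum_completions_cons ha, columnBounds, seqWeight]
    refine Finset.sum_nbij' (· - j) (· + j) ?_ ?_ ?_ ?_ ?_
    · intro c hc; rw [Finset.mem_Icc] at hc ⊢; omega
    · intro d hd; rw [Finset.mem_Icc] at hd ⊢; omega
    · intro c hc; rw [Finset.mem_Icc] at hc; omega
    · intro d hd; omega
    · intro c hc
      rw [Finset.mem_Icc] at hc
      have hcm : c < m := column_lt (by omega) (by omega) hc.2
      have h := ih hα' (i := c + 1) (j := j + 1) (A := A + a) (by omega) (by omega) (by omega)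
        (by omega)
      rw [Nat.add_sub_add_right] at h
      rw [← h, Finset.mul_sum]
      refine Finset.sum_congr rfl fun Q _ => ?_
      have e : (A * m - i * n : ℤ) - (c - i : ℕ) * n = A * m - c * n := by
        push_cast [hc.1]; ring
      have h0 : 0 ≤ (A * m - i * n : ℤ) - (c - i : ℕ) * n := by
        rw [e]; exact (rank_nonneg_iff hn).2 hc.2
      have hp : (if i = j then p ^ firstGap (blockCons (c - i) a Q) else 1) =
          (if c - j = 0 then p else 1) * (if c + 1 = j + 1 then p ^ firstGap Q else 1) := by
        by_cases hcj : c = j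
        · obtain rfl : i = c := by omega
          subst hcj
          simp [blockCons, firstGap_replicate_true_append ha, pow_succ']
        · rw [if_neg (show c - j ≠ 0 by omega), if_neg (show c + 1 ≠ j + 1 by omega)]
          split_ifs with hij
          · obtain ⟨k, hk⟩ : ∃ k, c - i = k + 1 := ⟨c - i - 1, by omega⟩
            rw [hk, blockCons, List.replicate_succ, List.cons_append, firstGap_cons_false]
            simp
          · simp
      have hq : (if (A * m - c * n : ℤ) < n then 1 else 0) =
          if c - j = m * A / n - j then 1 else 0 := by
        refine if_congr ((rank_lt_iff hn hc.2).trans ?_) rfl rfl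
        omega
      rw [retFrom_blockCons hmn ha Q h0, hp, rank_blockCons hc.1, e, hq, pow_add]
      split_ifs <;> ring

lemma sum_dyckPathsComp_eq_seqWeight {R : Type*} [CommRing R] (p q : R) {m n : ℕ} (hn : 0 < n)
    (hmn : n < m) {α : List ℕ} (hα : IsComposition n α) :
    ∑ P ∈ dyckPathsComp m n α, p ^ runStat P * q ^ retStat m n P =
      seqWeight p q (columnBounds m n α 0 0) 0 := by
  rw [dyckPathsComp_eq_completions hn hmn hα]
  have h := sum_completions_eq_seqWeight p q hn hmn hα.1 (i := 0) (j := 0) (A := 0)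
    (by simpa using hα.2) (Nat.zero_le _) le_rfl le_rfl
  simp only [if_true, Nat.cast_zero, zero_mul, sub_zero] at h
  rw [← h]
  refine Finset.sum_congr rfl fun P hP => ?_
  rw [retStat_eq_retFrom, runStat_eq_firstGap]
  rw [mem_completions hn hmn hα.1 (by simpa using hα.2) (Nat.zero_le _)] at hP
  obtain ⟨-, h2, h3, -⟩ := hP
  rcases P with _ | ⟨_ | _, P⟩
  · simp at h2; omega
  · have := h3.2.nonneg
    simp [stepRank] at this
    omega
  · simp [coarea_cons]

open MvPolynomial in
/-- For `m > n` and a composition `α ⊨ n`, the joint distribution of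
`(run, ret)` on `D_{m,α}` is symmetric, as an identity of polynomials in `p = X 0` and
`q = X 1`. -/
theorem run_ret_symmetric_comp (m n : ℕ) (hn : 0 < n) (hmn : n < m)
    (α : List ℕ) (hα : IsComposition n α) :
    (∑ P ∈ dyckPathsComp m n α,
        (X 0 : MvPolynomial (Fin 2) ℚ) ^ runStat P * (X 1) ^ retStat m n P) =
      ∑ P ∈ dyckPathsComp m n α,
        (X 0 : MvPolynomial (Fin 2) ℚ) ^ retStat m n P * (X 1) ^ runStat P := by
  rw [sum_dyckPathsComp_eq_seqWeight _ _ hn hmn hα,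
    seqWeight_comm _ _ (isChain_columnBounds hn hmn hα.1 0 0),
    ← sum_dyckPathsComp_eq_seqWeight _ _ hn hmn hα]
  exact Finset.sum_congr rfl fun P _ => mul_comm _ _

end RationalDyck
end
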